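/- Let Z be a minimal Banach space not containing an isomorphic copy of ℓ₁, and let A be an analytic subset of NC_Z. Then there exists an analytic subset A' of NC_Z such that: (i) every Y ∈ A' has a Schauder basis; (ii) for every X ∈ A there exists Y ∈ A' containing an isometric copy of X. -/

import Mathlib

open Filter Topology MeasureTheory

noncomputable section

/-! ### The Cantor set and the space `C(2^ℕ)` -/

/-- The Cantor set `2^ℕ`. -/
abbrev CantorSet : Type := ℕ → Bool

/-- The Banach space `C(2^ℕ)` of continuous real-valued functions on the Cantor set. -/
abbrev CantorC : Type := C(CantorSet, ℝ)

/-! ### The standard Borel space `SB` of separable Banach spaces -/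

/-- `SB`: the set of closed linear subspaces of `C(2^ℕ)`. -/
def SB : Type := {Y : Submodule ℝ CantorC // IsClosed (Y : Set CantorC)}

/-- The Effros-Borel σ-algebra on `SB`, generated by the sets
`{Y : Y ∩ U ≠ ∅}` for `U` open in `C(2^ℕ)`. -/
instance : MeasurableSpace SB :=
  MeasurableSpace.generateFrom
    {A : Set SB | ∃ U : Set CantorC, IsOpen U ∧ A = {Y : SB | ((Y.1 : Set CantorC) ∩ U).Nonempty}}

/-- A subset of a standard Borel space is analytic if it is the image of a Borel map
from the Baire space `ℕ^ℕ`. -/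
def IsAnalyticIn {α : Type*} [MeasurableSpace α] (A : Set α) : Prop :=
  ∃ f : (ℕ → ℕ) → α, Measurable f ∧ A = Set.range f

/-! ### Embeddings, isomorphisms, universality -/

/-- `X` embeds isomorphically into `Y`: there is a bounded linear map which is
bounded below, i.e. an isomorphism onto its range. -/
def Embeds (X Y : Type*) [SeminormedAddCommGroup X] [NormedSpace ℝ X]
    [SeminormedAddCommGroup Y] [NormedSpace ℝ Y] : Prop :=
  ∃ (T : X →L[ℝ] Y) (c : ℝ), 0 < c ∧ ∀ x : X, c * ‖x‖ ≤ ‖T x‖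

/-- `X` embeds isometrically into `Y` (i.e. `Y` contains an isometric copy of `X`). -/
def EmbedsIsometrically (X Y : Type*) [SeminormedAddCommGroup X] [NormedSpace ℝ X]
    [SeminormedAddCommGroup Y] [NormedSpace ℝ Y] : Prop :=
  Nonempty (X →ₗᵢ[ℝ] Y)

/-- `X` and `Y` are isomorphic Banach spaces (linearly homeomorphic). -/
def IsomorphicTo (X Y : Type*) [SeminormedAddCommGroup X] [NormedSpace ℝ X]
    [SeminormedAddCommGroup Y] [NormedSpace ℝ Y] : Prop :=
  Nonempty (X ≃L[ℝ] Y)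

/-- The class `NU ⊆ SB` of non-universal spaces: those `X ∈ SB` which do not contain
an isomorphic copy of `C(2^ℕ)` (equivalently, are not universal for all separable
Banach spaces). -/
def NU : Set SB := {Y : SB | ¬ Embeds CantorC Y.1}

/-- The class `NC_X ⊆ SB` of all `Y ∈ SB` containing no isomorphic copy of `X`. -/
def NCin (X : Type*) [SeminormedAddCommGroup X] [NormedSpace ℝ X] : Set SB :=
  {Y : SB | ¬ Embeds X Y.1}

/-! ### Schauder bases -/

/-- `x` is a Schauder basis of `E`: every vector has a unique representation as a
norm convergent series `Σ aₙ • xₙ`. -/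
def IsSchauderBasis {E : Type*} [SeminormedAddCommGroup E] [NormedSpace ℝ E]
    (x : ℕ → E) : Prop :=
  ∀ y : E, ∃! a : ℕ → ℝ,
    Tendsto (fun m => ∑ n ∈ Finset.range m, a n • x n) atTop (𝓝 y)

/-- `E` has a Schauder basis. -/
def HasSchauderBasis (E : Type*) [SeminormedAddCommGroup E] [NormedSpace ℝ E] : Prop :=
  ∃ x : ℕ → E, IsSchauderBasis x

/-- `x` is a monotone basis sequence: initial-segment projections have norm at most 1. -/
def IsMonotoneSeq {E : Type*} [SeminormedAddCommGroup E] [NormedSpace ℝ E]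
    (x : ℕ → E) : Prop :=
  ∀ (a : ℕ → ℝ) (k m : ℕ), k ≤ m →
    ‖∑ n ∈ Finset.range k, a n • x n‖ ≤ ‖∑ n ∈ Finset.range m, a n • x n‖

/-- `x` is a bi-monotone sequence: interval projections have norm at most 1. -/
def IsBimonotoneSeq {E : Type*} [SeminormedAddCommGroup E] [NormedSpace ℝ E]
    (x : ℕ → E) : Prop :=
  ∀ (a : ℕ → ℝ) (j k m : ℕ), j ≤ k → k ≤ m →
    ‖∑ n ∈ Finset.Ico j k, a n • x n‖ ≤ ‖∑ n ∈ Finset.range m, a n • x n‖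

/-- `x` is a Schauder basic sequence: it is a Schauder basis of its closed linear span. -/
def IsSchauderBasicSeq {E : Type*} [NormedAddCommGroup E] [NormedSpace ℝ E]
    (x : ℕ → E) : Prop :=
  ∀ y ∈ (Submodule.span ℝ (Set.range x)).topologicalClosure,
    ∃! a : ℕ → ℝ,
      Tendsto (fun m => ∑ n ∈ Finset.range m, a n • x n) atTop (𝓝 y)

/-! ### Trees, ordinal ranks and Bourgain's index -/

/-- A tree on `Λ`: a set of finite sequences closed under initial segments. -/
def IsTree {Λ : Type*} (T : Set (List Λ)) : Prop :=
  ∀ s t : List Λ, s <+: t → t ∈ T → s ∈ T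

/-- A pruned tree: every node has a proper extension in the tree. -/
def IsPruned {Λ : Type*} (T : Set (List Λ)) : Prop :=
  ∀ t ∈ T, ∃ a : Λ, t ++ [a] ∈ T

/-- `σ` is an infinite branch of `T`. -/
def IsBranch {Λ : Type*} (T : Set (List Λ)) (σ : ℕ → Λ) : Prop :=
  ∀ n : ℕ, (List.ofFn fun i : Fin n => σ i) ∈ T

/-- `T` is ill-founded: it has an infinite branch. -/
def TreeIllFounded {Λ : Type*} (T : Set (List Λ)) : Prop :=
  ∃ σ : ℕ → Λ, IsBranch T σ

/-- The derivative of a tree: its non-maximal nodes, i.e. nodes having a proper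
extension in the tree. -/
def treeDeriv {Λ : Type*} (T : Set (List Λ)) : Set (List Λ) :=
  {l | l ∈ T ∧ ∃ a : Λ, l ++ [a] ∈ T}

/-- The iterated derivatives `T^(ξ)` of a tree, defined by transfinite recursion. -/
def treeDerivIter {Λ : Type*} (T : Set (List Λ)) (ξ : Ordinal.{0}) : Set (List Λ) :=
  Ordinal.limitRecOn ξ T (fun _ S => treeDeriv S)
    (fun o _ ih => ⋂ (o' : Ordinal.{0}) (h : o' < o), ih o' h)

/-- The ordinal rank `o(T)` of a (well-founded) tree: the least `ξ` with `T^(ξ) = ∅`. -/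
def treeRank {Λ : Type*} (T : Set (List Λ)) : Ordinal.{0} :=
  sInf {ξ : Ordinal.{0} | treeDerivIter T ξ = ∅}

/-- The first uncountable ordinal `ω₁`. -/
def omega1 : Ordinal.{0} := (Cardinal.aleph 1).ord

/-- Bourgain's tree `T(Y, (e_n), δ)`: all finite sequences `(y_0, …, y_k)` in `Y`
which are `δ`-equivalent to `(e_0, …, e_k)`. -/
def bourgainTree {W : Type*} [SeminormedAddCommGroup W] [NormedSpace ℝ W] (e : ℕ → W)
    (δ : ℝ) (Y : Type*) [SeminormedAddCommGroup Y] [NormedSpace ℝ Y] : Set (List Y) :=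
  {l : List Y | ∀ a : ℕ → ℝ,
    δ * ‖∑ i ∈ Finset.range l.length, a i • e i‖ ≤
        ‖∑ i ∈ Finset.range l.length, a i • l.getD i 0‖ ∧
    ‖∑ i ∈ Finset.range l.length, a i • l.getD i 0‖ ≤
        δ⁻¹ * ‖∑ i ∈ Finset.range l.length, a i • e i‖}

open Classical in
/-- Bourgain's ordinal index of `Y` relative to a (normalized Schauder) basis `(e_n)`
of a space `W`: it equals `ω₁` if some tree `T(Y, (e_n), δ)` is ill-founded, and
otherwise `sup_{0 < δ ≤ 1} o(T(Y, (e_n), δ))`.  With `W = C(2^ℕ)` this is `φ_NU`,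
and with `W = Z` it is `φ_{NC_Z}`. -/
def bourgainIndex {W : Type*} [SeminormedAddCommGroup W] [NormedSpace ℝ W] (e : ℕ → W)
    (Y : Type*) [SeminormedAddCommGroup Y] [NormedSpace ℝ Y] : Ordinal.{0} :=
  if ∃ δ ∈ Set.Ioc (0:ℝ) 1, TreeIllFounded (bourgainTree e δ Y) then omega1
  else ⨆ δ : Set.Ioc (0:ℝ) 1, treeRank (bourgainTree e δ.1 Y)

/-! ### The Schur property and the Radon-Nikodym property -/

/-- `X` has the Schur property: weakly convergent sequences are norm convergent. -/
def HasSchurProperty (X : Type*) [SeminormedAddCommGroup X] [NormedSpace ℝ X] : Prop :=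
  ∀ (f : ℕ → X) (x : X),
    (∀ φ : X →L[ℝ] ℝ, Tendsto (fun n => φ (f n)) atTop (𝓝 (φ x))) →
    Tendsto f atTop (𝓝 x)

/-- `X` has the Radon-Nikodym property: on every finite measure space, every
`X`-valued vector measure of bounded variation which is absolutely continuous
with respect to the measure has a Bochner-integrable density. -/
def HasRNP (X : Type*) [NormedAddCommGroup X] [NormedSpace ℝ X] : Prop :=
  ∀ (Ω : Type) [MeasurableSpace Ω] (μ : Measure Ω), IsFiniteMeasure μ →
    ∀ τ : VectorMeasure Ω X,
      (∀ s : Set Ω, MeasurableSet s → μ s = 0 → τ s = 0) →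
      (∃ C : ℝ, ∀ P : Finset (Set Ω), (∀ s ∈ P, MeasurableSet s) →
        ((P : Set (Set Ω)).Pairwise fun s t => Disjoint s t) →
        ∑ s ∈ P, ‖τ s‖ ≤ C) →
      ∃ g : Ω → X, Integrable g μ ∧
        ∀ s : Set Ω, MeasurableSet s → τ s = ∫ x in s, g x ∂μ

/-! ### `𝓛_{∞,λ}`-spaces -/

/-- The Banach-Mazur distance from `G` to `ℓ∞^n` is at most `θ`, witnessed by an
isomorphism `e` with `‖e‖ ⬝ ‖e⁻¹‖ ≤ θ'` for every `θ' > θ`. -/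
def BMdistToLinftyLE (G : Type*) [SeminormedAddCommGroup G] [NormedSpace ℝ G]
    (n : ℕ) (θ : ℝ) : Prop :=
  ∀ θ' : ℝ, θ < θ' → ∃ e : G ≃L[ℝ] (Fin n → ℝ),
    ‖(e : G →L[ℝ] (Fin n → ℝ))‖ * ‖(e.symm : (Fin n → ℝ) →L[ℝ] G)‖ ≤ θ'

/-- `X` is an (infinite-dimensional) `𝓛_{∞,λ}`-space: every finite-dimensional subspace
`F` of `X` is contained in a finite-dimensional subspace `G` with `d(G, ℓ∞^(dim G)) ≤ λ`. -/
def IsLinftyLam (lam : ℝ) (X : Type*) [NormedAddCommGroup X] [NormedSpace ℝ X] : Prop :=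
  (¬ FiniteDimensional ℝ X) ∧
  ∀ F : Submodule ℝ X, FiniteDimensional ℝ F →
    ∃ G : Submodule ℝ X, F ≤ G ∧ FiniteDimensional ℝ G ∧
      BMdistToLinftyLE G (Module.finrank ℝ G) lam

/-- `X` is an `𝓛_{∞,λ+}`-space: it is an `𝓛_{∞,θ}`-space for every `θ > λ`. -/
def IsLinftyPlus (lam : ℝ) (X : Type*) [NormedAddCommGroup X] [NormedSpace ℝ X] : Prop :=
  ∀ θ : ℝ, lam < θ → IsLinftyLam θ X

/-! ### Minimal spaces and `ℓ₁` -/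

/-- The space `ℓ₁`. -/
abbrev EllOne : Type := lp (fun _ : ℕ => ℝ) 1

/-- `X` is a minimal Banach space: it is infinite-dimensional and embeds isomorphically
into every infinite-dimensional (closed) subspace of itself. -/
def IsMinimal (X : Type*) [NormedAddCommGroup X] [NormedSpace ℝ X] : Prop :=
  (¬ FiniteDimensional ℝ X) ∧
  ∀ Z : Submodule ℝ X, IsClosed (Z : Set X) → ¬ FiniteDimensional ℝ Z → Embeds X Z

end


theorem bm_embedding (p : Seminorm ℝ (ℕ →₀ ℝ)) :
    ∃ G : (ℕ →₀ ℝ) →ₗ[ℝ] CantorC, ∀ a, ‖G a‖ = p a := by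
  classical
  let ev : (ℕ →₀ ℝ) → (ℕ → ℝ) → ℝ := fun a φ => a.sum fun i r => r * φ i
  have ev_cont : ∀ a, Continuous (ev a) := by
    intro a
    simp only [ev, Finsupp.sum]
    fun_prop
  let K : Set (ℕ → ℝ) := {φ | ∀ a, |ev a φ| ≤ p a}
  have hKcl : IsClosed K := by
    have : K = ⋂ a, {φ | |ev a φ| ≤ p a} := by ext; simp [K]
    rw [this]
    exact isClosed_iInter fun a => isClosed_le (ev_cont a).abs continuous_const
  have hKc : IsCompact K := by
    have hb : IsCompact (Set.pi Set.univ fun i : ℕ =>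
        Set.Icc (-(p (Finsupp.single i 1))) (p (Finsupp.single i 1))) :=
      isCompact_univ_pi fun i => isCompact_Icc
    refine hb.of_isClosed_subset hKcl ?_
    intro φ hφ i _
    have := hφ (Finsupp.single i 1)
    simp only [ev, zero_mul, Finsupp.sum_single_index, one_mul] at this
    exact abs_le.mp this
  have hK0 : (0 : ℕ → ℝ) ∈ K := by
    intro a
    simp [ev]
  have : Nonempty K := ⟨⟨0, hK0⟩⟩
  have : CompactSpace K := isCompact_iff_compactSpace.mp hKc
  let _ : MetricSpace K := TopologicalSpace.metrizableSpaceMetric K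
  obtain ⟨ψ, hψc, hψs⟩ := exists_nat_bool_continuous_surjective_of_compact K
  let G : (ℕ →₀ ℝ) →ₗ[ℝ] CantorC :=
    { toFun := fun a => ⟨fun t => ev a (ψ t).1,
        (ev_cont a).comp (continuous_subtype_val.comp hψc)⟩
      map_add' := by
        intro a b
        ext t
        simp only [ContinuousMap.coe_mk, ContinuousMap.add_apply, ev]
        rw [Finsupp.sum_add_index'] <;> intros <;> ring
      map_smul' := by
        intro c a
        ext t
        simp only [ContinuousMap.coe_mk, ContinuousMap.smul_apply, ev, RingHom.id_apply]
        rw [Finsupp.sum_smul_index' (by intros; simp), Finsupp.smul_sum]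
        simp [mul_assoc] }
  refine ⟨G, fun a => le_antisymm ?_ ?_⟩
  · rw [ContinuousMap.norm_le _ (apply_nonneg p a)]
    intro t
    exact (ψ t).2 a
  · -- Hahn-Banach
    obtain ⟨g, hg1, hg2⟩ : ∃ g : (ℕ →₀ ℝ) →ₗ[ℝ] ℝ, g a = p a ∧ ∀ x, g x ≤ p x := by
      by_cases ha : a = 0
      · refine ⟨0, by simp [ha], fun x => by simp⟩
      obtain ⟨g, hg1, hg2⟩ := exists_extension_of_le_sublinear
        (LinearPMap.mkSpanSingleton (K := ℝ) a (p a) ha) p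
        (fun c hc x => by rw [map_smul_eq_mul, Real.norm_of_nonneg hc.le])
        (fun x y => map_add_le_add p x y) (by
          rintro ⟨x, hx⟩
          obtain ⟨c, rfl⟩ := Submodule.mem_span_singleton.mp hx
          have h3 := LinearPMap.mkSpanSingleton'_apply (R := ℝ) a (p a)
            (fun c hc => by
              rcases smul_eq_zero.mp hc with h | h
              · simp [h]
              · exact absurd h ha) c hx
          change LinearPMap.mkSpanSingleton' _ _ _ _ ≤ p (c • a)
          rw [h3]
          rw [map_smul_eq_mul, smul_eq_mul]
          exact mul_le_mul_of_nonneg_right (le_abs_self c) (apply_nonneg p a))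
      refine ⟨g, ?_, hg2⟩
      have := hg1 ⟨a, Submodule.mem_span_singleton_self a⟩
      rw [this]
      exact LinearPMap.mkSpanSingleton_apply ℝ ℝ ha (p a)
    have hev : ∀ b, ev b (fun i => g (Finsupp.single i 1)) = g b := by
      intro b
      simp only [ev]
      conv_rhs => rw [← Finsupp.sum_single b]
      rw [map_finsuppSum]
      refine Finsupp.sum_congr fun i _ => ?_
      rw [← smul_eq_mul, ← map_smul]; simp
    have hgK : (fun i => g (Finsupp.single i 1)) ∈ K := by
      intro b
      rw [hev, abs_le]
      refine ⟨?_, hg2 b⟩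
      have := hg2 (-b)
      rw [map_neg, map_neg_eq_map] at this
      linarith
    obtain ⟨t, ht⟩ := hψs ⟨_, hgK⟩
    have h1 : (G a) t = p a := by
      simp only [G, LinearMap.coe_mk, AddHom.coe_mk, ContinuousMap.coe_mk]
      rw [ht, hev, hg1]
    calc p a ≤ ‖(G a) t‖ := by rw [h1]; exact le_abs_self _
      _ ≤ ‖G a‖ := ContinuousMap.norm_coe_le_norm _ _

/-- The closure of the range of a linear map out of `c₀₀`. -/
noncomputable def clRange {B : Type*} [NormedAddCommGroup B] [NormedSpace ℝ B] (G : (ℕ →₀ ℝ) →ₗ[ℝ] B) :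
    Submodule ℝ B := (LinearMap.range G).topologicalClosure

theorem mem_clRange {B : Type*} [NormedAddCommGroup B] [NormedSpace ℝ B]
    (G : (ℕ →₀ ℝ) →ₗ[ℝ] B) (a : ℕ →₀ ℝ) : G a ∈ clRange G :=
  Submodule.le_topologicalClosure _ ⟨a, rfl⟩

/-- corestriction of `G` to the closure of its range. -/
noncomputable def toCl {B : Type*} [NormedAddCommGroup B] [NormedSpace ℝ B] (G : (ℕ →₀ ℝ) →ₗ[ℝ] B) :
    (ℕ →₀ ℝ) →ₗ[ℝ] clRange G := G.codRestrict _ (mem_clRange G)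

theorem exists_approx {B : Type*} [NormedAddCommGroup B] [NormedSpace ℝ B]
    (G : (ℕ →₀ ℝ) →ₗ[ℝ] B) (y : clRange G) {ε : ℝ} (hε : 0 < ε) :
    ∃ a, ‖y - toCl G a‖ < ε := by
  have h : (y : B) ∈ closure (LinearMap.range G : Set B) := y.2
  obtain ⟨b, ⟨a, rfl⟩, hb⟩ := Metric.mem_closure_iff.mp h ε hε
  exact ⟨a, by rw [dist_eq_norm] at hb; exact hb⟩

theorem toCl_dense {B : Type*} [NormedAddCommGroup B] [NormedSpace ℝ B]
    (G : (ℕ →₀ ℝ) →ₗ[ℝ] B) : DenseRange (toCl G) := by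
  intro y
  rw [Metric.mem_closure_iff]
  intro ε hε
  obtain ⟨a, ha⟩ := exists_approx G y hε
  exact ⟨_, ⟨a, rfl⟩, by rw [dist_eq_norm]; exact ha⟩

theorem ext_lemma {B F : Type*} [NormedAddCommGroup B] [NormedSpace ℝ B]
    [NormedAddCommGroup F] [NormedSpace ℝ F] [CompleteSpace F]
    (G : (ℕ →₀ ℝ) →ₗ[ℝ] B) (V : (ℕ →₀ ℝ) →ₗ[ℝ] F) (K : ℝ) (h : ∀ a, ‖V a‖ ≤ K * ‖G a‖) :
    ∃ q : clRange G →L[ℝ] F, (∀ a, q (toCl G a) = V a) ∧ ∀ y, ‖q y‖ ≤ K * ‖y‖ := by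
  refine ⟨V.extendOfNorm (toCl G), fun a => ?_, fun y => ?_⟩
  · exact LinearMap.extendOfNorm_eq (toCl_dense G) ⟨K, h⟩ a
  · exact LinearMap.norm_extendOfNorm_apply_le (toCl_dense G) K h y

theorem filter_lt_eq (a : ℕ →₀ ℝ) (m : ℕ) :
    a.filter (· < m) = ∑ j ∈ Finset.range m, Finsupp.single j (a j) := by
  ext i
  rw [Finsupp.filter_apply, Finsupp.finsetSum_apply]
  simp [Finsupp.single_apply]

theorem filter_lt_eventually (a : ℕ →₀ ℝ) : ∃ M, ∀ m ≥ M, a.filter (· < m) = a := by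
  refine ⟨a.support.sup id + 1, fun m hm => ?_⟩
  rw [Finsupp.filter_eq_self_iff]
  intro i hi
  have : i ≤ a.support.sup id := Finset.le_sup (f := id) (Finsupp.mem_support_iff.mpr hi)
  omega

theorem coord_bound {B : Type*} [NormedAddCommGroup B] [NormedSpace ℝ B]
    (G : (ℕ →₀ ℝ) →ₗ[ℝ] B) (C : ℝ)
    (hG : ∀ a m, ‖G (a.filter (· < m))‖ ≤ C * ‖G a‖) (a : ℕ →₀ ℝ) (j : ℕ) :
    |a j| * ‖G (Finsupp.single j 1)‖ ≤ 2 * C * ‖G a‖ := by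
  have h1 : G (a.filter (· < j + 1)) - G (a.filter (· < j)) = a j • G (Finsupp.single j 1) := by
    rw [filter_lt_eq, filter_lt_eq, Finset.sum_range_succ, map_add, add_sub_cancel_left, ← map_smul]
    simp
  have h2 : ‖a j • G (Finsupp.single j 1)‖ ≤ C * ‖G a‖ + C * ‖G a‖ := by
    rw [← h1]
    exact (norm_sub_le _ _).trans (add_le_add (hG a _) (hG a _))
  rw [norm_smul, Real.norm_eq_abs] at h2
  linarith

theorem exists_coord {B : Type*} [NormedAddCommGroup B] [NormedSpace ℝ B]
    (G : (ℕ →₀ ℝ) →ₗ[ℝ] B) (C : ℝ) (hG0 : ∀ j, G (Finsupp.single j 1) ≠ 0)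
    (hG : ∀ a m, ‖G (a.filter (· < m))‖ ≤ C * ‖G a‖) :
    ∃ c : ℕ → (clRange G →L[ℝ] ℝ), ∀ j a, c j (toCl G a) = a j := by
  have : ∀ j, ∃ q : clRange G →L[ℝ] ℝ, (∀ a, q (toCl G a) = a j) := by
    intro j
    obtain ⟨q, hq, -⟩ := ext_lemma G (Finsupp.lapply j)
      (2 * C / ‖G (Finsupp.single j 1)‖) (fun a => by
        have := coord_bound G C hG a j
        have hp : 0 < ‖G (Finsupp.single j 1)‖ := norm_pos_iff.mpr (hG0 j)
        rw [div_mul_eq_mul_div, le_div_iff₀ hp]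
        simpa using this)
    exact ⟨q, hq⟩
  choose c hc using this
  exact ⟨c, hc⟩

theorem schauder_of_bound {B : Type*} [NormedAddCommGroup B] [NormedSpace ℝ B]
    (G : (ℕ →₀ ℝ) →ₗ[ℝ] B) (C : ℝ) (hC : 0 ≤ C) (hG0 : ∀ j, G (Finsupp.single j 1) ≠ 0)
    (hG : ∀ a m, ‖G (a.filter (· < m))‖ ≤ C * ‖G a‖) :
    HasSchauderBasis (clRange G) := by
  obtain ⟨c, hc⟩ := exists_coord G C hG0 hG
  let w : ℕ → clRange G := fun j => toCl G (Finsupp.single j 1)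
  have hfil : ∀ (a : ℕ →₀ ℝ) m, toCl G (a.filter (· < m)) = ∑ j ∈ Finset.range m, a j • w j := by
    intro a m
    rw [filter_lt_eq, map_sum]
    refine Finset.sum_congr rfl fun j _ => ?_
    simp only [w]
    rw [← map_smul]; simp
  have hcw : ∀ i j, c i (w j) = if j = i then 1 else 0 := by
    intro i j
    simp only [w, hc, Finsupp.single_apply]
  refine ⟨w, fun y => ⟨fun j => c j y, ?_, ?_⟩⟩
  · -- convergence
    have hS : ∀ m, ∀ y : clRange G, ‖∑ j ∈ Finset.range m, c j y • w j‖ ≤ C * ‖y‖ := by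
      intro m y
      refine (toCl_dense G).induction_on (p := fun y : clRange G =>
        ‖∑ j ∈ Finset.range m, c j y • w j‖ ≤ C * ‖y‖) y ?_ ?_
      · refine isClosed_le ?_ ?_ <;> fun_prop
      · intro a
        simp only [hc, ← hfil]
        exact hG a m
    beta_reduce
    rw [Metric.tendsto_atTop]
    intro ε hε
    obtain ⟨a, ha⟩ := exists_approx G y (ε := ε / (C + 1)) (by positivity)
    obtain ⟨M, hM⟩ := filter_lt_eventually a
    refine ⟨M, fun m hm => ?_⟩
    have h1 : ∑ j ∈ Finset.range m, c j (toCl G a) • w j = toCl G a := by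
      simp only [hc, ← hfil]; rw [hM m hm]
    have h2 := hS m (y - toCl G a)
    have h3 : ∑ j ∈ Finset.range m, c j (y - toCl G a) • w j
        = ∑ j ∈ Finset.range m, c j y • w j - toCl G a := by
      rw [← h1, ← Finset.sum_sub_distrib, h1]
      simp [sub_smul]
    rw [h3] at h2
    rw [dist_eq_norm]
    have h4 : ∑ j ∈ Finset.range m, c j y • w j - y
        = (∑ j ∈ Finset.range m, c j y • w j - toCl G a) - (y - toCl G a) := by abel
    change ‖∑ j ∈ Finset.range m, c j y • w j - y‖ < ε
    rw [h4]
    calc _ ≤ C * ‖y - toCl G a‖ + ‖y - toCl G a‖ := (norm_sub_le _ _).trans (by gcongr)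
      _ = (C + 1) * ‖y - toCl G a‖ := by ring
      _ < (C + 1) * (ε / (C + 1)) := by gcongr
      _ = ε := by field_simp
  · intro a ha
    funext i
    have h1 : Tendsto (fun m => c i (∑ n ∈ Finset.range m, a n • w n)) atTop (𝓝 (c i y)) :=
      ((c i).continuous.tendsto y).comp ha
    refine tendsto_nhds_unique ?_ h1
    refine tendsto_const_nhds.congr' ?_
    filter_upwards [eventually_gt_atTop i] with m hm
    simp [map_sum, hcw, hm]

theorem exists_unit_killed {Z : Type*} [NormedAddCommGroup Z] [NormedSpace ℝ Z]
    (hZ : ¬ FiniteDimensional ℝ Z) (l : Finset (Z →L[ℝ] ℝ)) :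
    ∃ z : Z, ‖z‖ = 1 ∧ ∀ φ ∈ l, φ z = 0 := by
  let Φ : Z →ₗ[ℝ] (l → ℝ) := LinearMap.pi fun φ => (φ.1 : Z →ₗ[ℝ] ℝ)
  have hni : ¬ Function.Injective Φ := fun h => hZ (Module.Finite.of_injective Φ h)
  rw [← LinearMap.ker_eq_bot, Submodule.eq_bot_iff] at hni
  push Not at hni
  obtain ⟨z, hz, hz0⟩ := hni
  have hk : ∀ φ ∈ l, φ z = 0 := fun φ hφ => congrFun (LinearMap.mem_ker.mp hz) ⟨φ, hφ⟩
  refine ⟨(‖z‖)⁻¹ • z, ?_, fun φ hφ => by rw [map_smul, hk φ hφ, smul_zero]⟩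
  rw [norm_smul, norm_inv, norm_norm, inv_mul_cancel₀ (norm_ne_zero_iff.mpr hz0)]

theorem embeds_ellOne {Z : Type*} [NormedAddCommGroup Z] [NormedSpace ℝ Z] [CompleteSpace Z]
    (z : ℕ → Z) (hz : ∀ k, ‖z k‖ = 1) (d : ℝ) (hd : 0 < d)
    (h : ∀ (a : ℕ → ℝ) K, d * ∑ k ∈ Finset.range K, |a k| ≤ ‖∑ k ∈ Finset.range K, a k • z k‖) :
    Embeds EllOne Z := by
  have hsumabs : ∀ a : EllOne, Summable fun k => |a k| := by
    intro a
    have := (lp.memℓp a).summable (by simp)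
    simpa using this
  have hnorm : ∀ a : EllOne, ‖a‖ = ∑' k, |a k| := by
    intro a
    have := lp.norm_eq_tsum_rpow (p := 1) (by simp) a
    simpa using this
  have hs : ∀ a : EllOne, Summable fun k => a k • z k := by
    intro a
    refine Summable.of_norm ?_
    simpa [norm_smul, hz] using hsumabs a
  let T0 : EllOne →ₗ[ℝ] Z :=
    { toFun := fun a => ∑' k, a k • z k
      map_add' := by
        intro a b
        rw [← (hs a).tsum_add (hs b)]
        simp [add_smul]
      map_smul' := by
        intro r a
        rw [RingHom.id_apply, ← (hs a).tsum_const_smul]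
        simp [mul_smul] }
  refine ⟨T0.mkContinuous 1 ?_, d, hd, ?_⟩
  · intro a
    rw [one_mul, hnorm]
    have := norm_tsum_le_tsum_norm (f := fun k => a k • z k)
      (by simpa [norm_smul, hz] using hsumabs a)
    simpa [norm_smul, hz, T0] using this
  · intro a
    have h1 : Tendsto (fun K => d * ∑ k ∈ Finset.range K, |a k|) atTop (𝓝 (d * ‖a‖)) := by
      rw [hnorm]
      exact ((hsumabs a).hasSum.tendsto_sum_nat).const_mul d
    have h2 : Tendsto (fun K => ‖∑ k ∈ Finset.range K, a k • z k‖) atTop (𝓝 ‖T0 a‖) :=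
      ((hs a).hasSum.tendsto_sum_nat).norm
    exact le_of_tendsto_of_tendsto' h1 h2 (fun K => h a K)

theorem Embeds.trans' {A B C : Type*} [SeminormedAddCommGroup A] [NormedSpace ℝ A]
    [SeminormedAddCommGroup B] [NormedSpace ℝ B] [SeminormedAddCommGroup C] [NormedSpace ℝ C]
    (h1 : Embeds A B) (h2 : Embeds B C) : Embeds A C := by
  obtain ⟨T, c, hc, hT⟩ := h1
  obtain ⟨U, d, hd, hU⟩ := h2
  refine ⟨U.comp T, d * c, mul_pos hd hc, fun x => ?_⟩
  calc d * c * ‖x‖ = d * (c * ‖x‖) := by ring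
    _ ≤ d * ‖T x‖ := by gcongr; exact hT x
    _ ≤ _ := hU _

/-- Gliding hump. -/
theorem case_one {Z F : Type*} [NormedAddCommGroup Z] [NormedSpace ℝ Z] [CompleteSpace Z]
    [NormedAddCommGroup F] [NormedSpace ℝ F]
    (hZ : ¬ FiniteDimensional ℝ Z)
    (q : ℕ → Z →L[ℝ] F) (C : ℝ) (hC : 0 < C)
    (hfin : ∀ n, ∃ l : Finset (Z →L[ℝ] ℝ), ∀ z, (∀ φ ∈ l, φ z = 0) → q n z = 0)
    (hsum : ∀ z m, ∑ n ∈ Finset.range m, ‖q n z‖ ≤ C * ‖z‖)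
    (l0 : Finset (Z →L[ℝ] ℝ)) (δ : ℝ) (hδ : 0 < δ)
    (hlow : ∀ z, ‖z‖ = 1 → (∀ φ ∈ l0, φ z = 0) → δ ≤ ∑' n, ‖q n z‖) : Embeds EllOne Z := by
  classical
  choose L hL using hfin
  have hsm : ∀ z, Summable fun n => ‖q n z‖ := fun z =>
    summable_of_sum_range_le (fun _ => norm_nonneg _) (hsum z)
  have hle : ∀ z m, ∑ n ∈ Finset.range m, ‖q n z‖ ≤ ∑' n, ‖q n z‖ := fun z m =>
    (hsm z).sum_le_tsum _ (fun _ _ => norm_nonneg _)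
  obtain ⟨f, hP, hr⟩ := exists_seq_of_forall_finset_exists
    (fun p : Z × ℕ => ‖p.1‖ = 1 ∧ δ ≤ ∑' n, ‖q n p.1‖ ∧
      ∑' n, ‖q n p.1‖ - δ / 4 ≤ ∑ n ∈ Finset.range p.2, ‖q n p.1‖)
    (fun p p' => p.2 ≤ p'.2 ∧ ∀ n < p.2, q n p'.1 = 0)
    (by
      intro s _
      let N := s.sup Prod.snd
      obtain ⟨z, hz1, hz2⟩ := exists_unit_killed hZ (l0 ∪ (Finset.range N).biUnion L)
      have hev : ∀ᶠ m in atTop, ∑' n, ‖q n z‖ - δ / 4 < ∑ n ∈ Finset.range m, ‖q n z‖ :=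
        (hsm z).hasSum.tendsto_sum_nat.eventually (lt_mem_nhds (by linarith))
      obtain ⟨M, hM1, hM2⟩ := (hev.and (eventually_ge_atTop N)).exists
      refine ⟨(z, M), ⟨hz1, hlow z hz1 fun φ hφ => hz2 φ (by simp [hφ]), hM1.le⟩, ?_⟩
      intro p hp
      have hpN : p.2 ≤ N := Finset.le_sup (f := Prod.snd) hp
      refine ⟨hpN.trans hM2, fun n hn => hL n z fun φ hφ => hz2 φ ?_⟩
      rw [Finset.mem_union, Finset.mem_biUnion]
      exact Or.inr ⟨n, Finset.mem_range.mpr (hn.trans_le hpN), hφ⟩)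
  let z : ℕ → Z := fun k => (f k).1
  let N : ℕ → ℕ := fun k => (f k).2
  have key : ∀ (a : ℕ → ℝ) K M, (∀ k < K, N k ≤ M) →
      ∑ k ∈ Finset.range K, |a k| * (2 * (∑' n, ‖q n (z k)‖ - δ / 4)
        - ∑ n ∈ Finset.range M, ‖q n (z k)‖)
      ≤ ∑ n ∈ Finset.range M, ‖q n (∑ k ∈ Finset.range K, a k • z k)‖ := by
    intro a K
    induction K with
    | zero => intro M _; simp
    | succ K ih =>
      intro M hM
      obtain ⟨L', hL'M, hL'1, hL'2⟩ : ∃ L' ≤ M, (∀ k < K, N k ≤ L') ∧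
          (∀ n < L', q n (z K) = 0) := by
        rcases K with _ | K
        · exact ⟨0, Nat.zero_le _, by simp, by simp⟩
        · refine ⟨N K, hM K (by omega), fun k hk => ?_, (hr K (K+1) (by omega)).2⟩
          rcases Nat.lt_succ_iff_lt_or_eq.mp hk with h | h
          · exact (hr k K h).1
          · rw [h]
      have h1 := ih L' hL'1
      set v := ∑ k ∈ Finset.range K, a k • z k with hv
      rw [Finset.sum_range_succ, Finset.sum_range_succ, ← hv]
      have split : ∀ g : ℕ → ℝ, ∑ n ∈ Finset.range M, g n
          = ∑ n ∈ Finset.range L', g n + ∑ n ∈ Finset.Ico L' M, g n := fun g =>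
        (Finset.sum_range_add_sum_Ico g hL'M).symm
      have h2 : ∑ n ∈ Finset.range L', ‖q n (v + a K • z K)‖ = ∑ n ∈ Finset.range L', ‖q n v‖ := by
        refine Finset.sum_congr rfl fun n hn => ?_
        rw [map_add, map_smul, hL'2 n (Finset.mem_range.mp hn), smul_zero, add_zero]
      have h3 : ∑ n ∈ Finset.Ico L' M, (|a K| * ‖q n (z K)‖ - ‖q n v‖)
          ≤ ∑ n ∈ Finset.Ico L' M, ‖q n (v + a K • z K)‖ := by
        refine Finset.sum_le_sum fun n _ => ?_
        rw [map_add, map_smul]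
        have := norm_sub_norm_le (a K • q n (z K)) (-(q n v))
        rw [norm_neg, norm_smul, Real.norm_eq_abs, sub_neg_eq_add, add_comm] at this
        linarith
      have h4 : ∑ n ∈ Finset.Ico L' M, ‖q n v‖
          ≤ ∑ k ∈ Finset.range K, |a k| * ∑ n ∈ Finset.Ico L' M, ‖q n (z k)‖ := by
        calc _ ≤ ∑ n ∈ Finset.Ico L' M, ∑ k ∈ Finset.range K, |a k| * ‖q n (z k)‖ := by
              refine Finset.sum_le_sum fun n _ => ?_
              rw [hv, map_sum]
              refine (norm_sum_le _ _).trans (Finset.sum_le_sum fun k _ => ?_)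
              rw [map_smul, norm_smul, Real.norm_eq_abs]
          _ = _ := by
              rw [Finset.sum_comm]
              simp [Finset.mul_sum]
      have h5 : ∑ n ∈ Finset.range L', ‖q n (z K)‖ = 0 :=
        Finset.sum_eq_zero fun n hn => by rw [hL'2 n (Finset.mem_range.mp hn), norm_zero]
      have h6 : ∑' n, ‖q n (z K)‖ - δ / 4 ≤ ∑ n ∈ Finset.range M, ‖q n (z K)‖ :=
        (hP K).2.2.trans (Finset.sum_le_sum_of_subset_of_nonneg
          (Finset.range_mono (hM K (by omega))) (fun _ _ _ => norm_nonneg _))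
      have h7 : |a K| * (2 * (∑' n, ‖q n (z K)‖ - δ / 4) - ∑ n ∈ Finset.range M, ‖q n (z K)‖)
          ≤ |a K| * ∑ n ∈ Finset.Ico L' M, ‖q n (z K)‖ := by
        have := split fun n => ‖q n (z K)‖
        exact mul_le_mul_of_nonneg_left (by linarith) (abs_nonneg _)
      have h8 : ∑ k ∈ Finset.range K, |a k| * (2 * (∑' n, ‖q n (z k)‖ - δ / 4)
        - ∑ n ∈ Finset.range M, ‖q n (z k)‖) = ∑ k ∈ Finset.range K, |a k| *
          (2 * (∑' n, ‖q n (z k)‖ - δ / 4) - ∑ n ∈ Finset.range L', ‖q n (z k)‖)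
          - ∑ k ∈ Finset.range K, |a k| * ∑ n ∈ Finset.Ico L' M, ‖q n (z k)‖ := by
        rw [← Finset.sum_sub_distrib]
        refine Finset.sum_congr rfl fun k _ => ?_
        rw [split fun n => ‖q n (z k)‖]
        ring
      rw [Finset.sum_sub_distrib, ← Finset.mul_sum] at h3
      rw [split fun n => ‖q n (v + a K • z K)‖, h2, h8]
      linarith
  refine embeds_ellOne z (fun k => (hP k).1) (δ / 2 / C) (by positivity) fun a K => ?_
  let M := (Finset.range K).sup N
  have h1 := key a K M fun k hk => Finset.le_sup (f := N) (Finset.mem_range.mpr hk)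
  have h2 := hsum (∑ k ∈ Finset.range K, a k • z k) M
  have h3 : (δ / 2) * ∑ k ∈ Finset.range K, |a k| ≤
      ∑ k ∈ Finset.range K, |a k| * (2 * (∑' n, ‖q n (z k)‖ - δ / 4)
        - ∑ n ∈ Finset.range M, ‖q n (z k)‖) := by
    rw [Finset.mul_sum]
    refine Finset.sum_le_sum fun k _ => ?_
    rw [mul_comm]
    refine mul_le_mul_of_nonneg_left ?_ (abs_nonneg _)
    have := hle (z k) M
    have := (hP k).2.1
    change δ ≤ ∑' n, ‖q n (z k)‖ at this
    linarith
  rw [div_mul_eq_mul_div, div_le_iff₀ hC]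
  linarith

theorem lin_eq_range {B : Type*} [AddCommGroup B] [Module ℝ B] (z : ℕ → B) (a : ℕ →₀ ℝ) :
    ∃ M, ∀ m ≥ M, Finsupp.linearCombination ℝ z a = ∑ j ∈ Finset.range m, a j • z j := by
  refine ⟨a.support.sup id + 1, fun m hm => ?_⟩
  rw [Finsupp.linearCombination_apply]
  refine Finsupp.sum_of_support_subset _ (fun i hi => ?_) _ (by simp)
  have : i ≤ a.support.sup id := Finset.le_sup (f := id) hi
  simp; omega

theorem case_two {Z Y : Type*} [NormedAddCommGroup Z] [NormedSpace ℝ Z] [CompleteSpace Z]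
    [NormedAddCommGroup Y] [NormedSpace ℝ Y] [CompleteSpace Y]
    (hmin : IsMinimal Z) (T : Z →L[ℝ] Y) (c : ℝ) (hc : 0 < c) (hT : ∀ z, c * ‖z‖ ≤ ‖T z‖)
    (X' : Submodule ℝ Y) (hX' : IsClosed (X' : Set Y))
    (h : ∀ (l : Finset (Z →L[ℝ] ℝ)) (δ : ℝ), 0 < δ → ∃ z, ‖z‖ = 1 ∧ (∀ φ ∈ l, φ z = 0) ∧
      ∃ x ∈ X', ‖T z - x‖ ≤ δ) : Embeds Z X' := by
  classical
  have : CompleteSpace X' := hX'.completeSpace_coe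
  obtain ⟨s, hP, hr⟩ := exists_seq_of_forall_finset_exists
    (fun p : (Z × (Z →L[ℝ] ℝ)) × (X' × ℕ) => ‖p.1.1‖ = 1 ∧ ‖p.1.2‖ ≤ 1 ∧ p.1.2 p.1.1 = 1 ∧
      ‖T p.1.1 - p.2.1‖ ≤ (c / 4) * (1 / 4) ^ p.2.2)
    (fun p p' => p.1.2 p'.1.1 = 0 ∧ p.2.2 < p'.2.2)
    (by
      intro t _
      obtain ⟨z, hz1, hz2, x, hx, hzx⟩ := h (t.image fun p => p.1.2)
        ((c / 4) * (1 / 4) ^ (t.sup (fun p => p.2.2) + 1)) (by positivity)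
      obtain ⟨f, hf1, hf2⟩ := exists_dual_vector ℝ z (by rw [← norm_ne_zero_iff, hz1]; simp)
      refine ⟨((z, f), (⟨x, hx⟩, t.sup (fun p => p.2.2) + 1)), ⟨hz1, hf1.le, ?_, hzx⟩, ?_⟩
      · simpa [hz1] using hf2
      · intro p hp
        refine ⟨hz2 _ (Finset.mem_image_of_mem _ hp), ?_⟩
        have : p.2.2 ≤ _ := Finset.le_sup (f := fun p : (Z × (Z →L[ℝ] ℝ)) × (X' × ℕ) => p.2.2) hp
        exact Nat.lt_succ_of_le this)
  let z : ℕ → Z := fun k => (s k).1.1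
  let f : ℕ → (Z →L[ℝ] ℝ) := fun k => (s k).1.2
  let x : ℕ → X' := fun k => (s k).2.1
  have hk : ∀ k, k ≤ (s k).2.2 := by
    intro k
    induction k with
    | zero => exact Nat.zero_le _
    | succ k ih => exact Nat.succ_le_of_lt (ih.trans_lt (hr k (k+1) (by omega)).2)
  have hzx : ∀ k, ‖T (z k) - x k‖ ≤ (c / 4) * (1 / 4) ^ k := fun k =>
    (hP k).2.2.2.trans (mul_le_mul_of_nonneg_left
      (pow_le_pow_of_le_one (by norm_num) (by norm_num) (hk k)) (by positivity))
  let G := Finsupp.linearCombination ℝ z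
  let V := Finsupp.linearCombination ℝ x
  have hco : ∀ (a : ℕ →₀ ℝ) k, |a k| ≤ 2 ^ k * ‖G a‖ := by
    intro a k
    induction k using Nat.strong_induction_on with
    | _ k ih =>
      obtain ⟨M, hM⟩ := lin_eq_range z a
      have h1 : f k (G a) = a k + ∑ j ∈ Finset.range k, a j * f k (z j) := by
        have h2 := hM (M + k + 1) (by omega)
        change G a = _ at h2
        rw [h2, map_sum, ← Finset.sum_subset (Finset.range_mono (show k + 1 ≤ M + k + 1 by omega)),
          Finset.sum_range_succ, add_comm]
        · have : f k (z k) = 1 := (hP k).2.2.1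
          simp [this]
        · intro j _ hj
          have : f k (z j) = 0 := (hr k j (by simpa using hj)).1
          rw [map_smul, this, smul_zero]
      have h3 : |f k (G a)| ≤ ‖G a‖ := by
        have := (f k).le_opNorm (G a)
        rw [Real.norm_eq_abs] at this
        exact this.trans (mul_le_of_le_one_left (norm_nonneg _) (hP k).2.1)
      have h4 : |∑ j ∈ Finset.range k, a j * f k (z j)| ≤ ∑ j ∈ Finset.range k, 2 ^ j * ‖G a‖ := by
        refine (Finset.abs_sum_le_sum_abs _ _).trans (Finset.sum_le_sum fun j hj => ?_)
        have h5 : |f k (z j)| ≤ 1 := by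
          have := (f k).le_opNorm (z j)
          rw [Real.norm_eq_abs] at this
          have h6 : ‖z j‖ = 1 := (hP j).1
          rw [h6, mul_one] at this
          exact this.trans (hP k).2.1
        rw [abs_mul]
        exact (mul_le_of_le_one_right (abs_nonneg _) h5).trans (ih j (Finset.mem_range.mp hj))
      rw [← Finset.sum_mul, geom_sum_eq (by norm_num)] at h4
      have h7 : a k = f k (G a) - ∑ j ∈ Finset.range k, a j * f k (z j) := by linarith
      rw [h7]
      refine (abs_sub _ _).trans ?_
      have : ((2:ℝ) ^ k - 1) / (2 - 1) * ‖G a‖ = 2 ^ k * ‖G a‖ - ‖G a‖ := by ring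
      linarith
  have hdiff : ∀ a, ‖T (G a) - V a‖ ≤ c / 2 * ‖G a‖ := by
    intro a
    obtain ⟨M, hM⟩ := lin_eq_range z a
    obtain ⟨M', hM'⟩ := lin_eq_range x a
    have h1 : G a = _ := hM (M + M') (by omega)
    have h2 : V a = _ := hM' (M + M') (by omega)
    have h3 : T (G a) - V a = ∑ j ∈ Finset.range (M + M'), a j • (T (z j) - x j) := by
      rw [h1, h2, map_sum]
      simp [smul_sub]
    rw [h3]
    calc _ ≤ ∑ j ∈ Finset.range (M + M'), (1 / 2) ^ j * (c / 4 * ‖G a‖) := by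
          refine (norm_sum_le _ _).trans (Finset.sum_le_sum fun j _ => ?_)
          rw [norm_smul, Real.norm_eq_abs]
          refine (mul_le_mul (hco a j) (hzx j) (norm_nonneg _) (by positivity)).trans_eq ?_
          have : ((1:ℝ)/2)^j = 2 ^ j * (1/4)^j := by rw [← mul_pow]; norm_num
          rw [this]; ring
      _ ≤ 2 * (c / 4 * ‖G a‖) := by
          rw [← Finset.sum_mul]
          exact mul_le_mul_of_nonneg_right (sum_geometric_two_le _) (by positivity)
      _ = _ := by ring
  have hinj : Function.Injective (toCl G) := by
    rw [← LinearMap.ker_eq_bot, Submodule.eq_bot_iff]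
    intro a ha
    have h0 : G a = 0 := congrArg Subtype.val (LinearMap.mem_ker.mp ha)
    ext k
    have := hco a k
    rw [h0, norm_zero, mul_zero] at this
    simpa using this
  have hinf : ¬ FiniteDimensional ℝ (clRange G) := by
    intro hfd
    have h1 : Module.Finite ℝ (ℕ →₀ ℝ) := Module.Finite.of_injective (toCl G) hinj
    have := Module.finite_finsupp_self_iff.mp h1
    rcases this with h | h
    · exact not_subsingleton ℝ h
    · exact not_finite ℕ
  obtain ⟨q, hq, -⟩ := ext_lemma G V (‖T‖ + c / 2) (by
    intro a
    have h1 := hdiff a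
    have h2 := T.le_opNorm (G a)
    have h3 := norm_sub_norm_le (V a : Y) (T (G a))
    rw [norm_sub_rev] at h3
    change ‖(V a : Y)‖ ≤ _
    linarith)
  refine (hmin.2 (clRange G) (Submodule.isClosed_topologicalClosure _) hinf).trans' ⟨q, c / 2, by positivity, ?_⟩
  refine fun y => (toCl_dense G).induction_on (p := fun y => c / 2 * ‖y‖ ≤ ‖q y‖) y
    (isClosed_le (by fun_prop) (by fun_prop)) fun a => ?_
  rw [hq]
  have h1 := hdiff a
  have h2 := hT (G a)
  have h3 := norm_sub_norm_le (T (G a)) (V a : Y)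
  change c / 2 * ‖G a‖ ≤ ‖(V a : Y)‖
  linarith

theorem not_embeds_of_quot {Z Y F : Type*} [NormedAddCommGroup Z] [NormedSpace ℝ Z]
    [CompleteSpace Z] [NormedAddCommGroup Y] [NormedSpace ℝ Y] [CompleteSpace Y]
    [NormedAddCommGroup F] [NormedSpace ℝ F]
    (hmin : IsMinimal Z) (hl1 : ¬ Embeds EllOne Z)
    (X' : Submodule ℝ Y) (hX' : IsClosed (X' : Set Y))
    (q : ℕ → Y →L[ℝ] F) (C : ℝ) (hC : 0 < C)
    (hfin : ∀ n, ∃ l : Finset (Y →L[ℝ] ℝ), ∀ y, (∀ φ ∈ l, φ y = 0) → q n y = 0)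
    (hsum : ∀ y m, ∑ n ∈ Finset.range m, ‖q n y‖ ≤ C * ‖y‖)
    (hdist : ∀ y ε, 0 < ε → ∃ x ∈ X', ‖y - x‖ ≤ C * ∑' n, ‖q n y‖ + ε)
    (hX : ¬ Embeds Z X') : ¬ Embeds Z Y := by
  classical
  rintro ⟨T, c, hc, hT⟩
  by_cases hcase : ∃ (l0 : Finset (Z →L[ℝ] ℝ)) (δ : ℝ), 0 < δ ∧
      ∀ z, ‖z‖ = 1 → (∀ φ ∈ l0, φ z = 0) → δ ≤ ∑' n, ‖q n (T z)‖
  · obtain ⟨l0, δ, hδ, hlow⟩ := hcase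
    refine hl1 (case_one hmin.1 (fun n => (q n).comp T) (C * (‖T‖ + 1)) (by positivity)
      (fun n => ?_) (fun z m => ?_) l0 δ hδ hlow)
    · obtain ⟨l, hl⟩ := hfin n
      refine ⟨l.image fun φ => φ.comp T, fun z hz => hl _ fun φ hφ => ?_⟩
      exact hz _ (Finset.mem_image_of_mem _ hφ)
    · refine (hsum (T z) m).trans ?_
      rw [mul_assoc]
      gcongr
      refine (T.le_opNorm z).trans ?_
      gcongr
      linarith
  · push Not at hcase
    refine hX (case_two hmin T c hc hT X' hX' fun l δ hδ => ?_)
    obtain ⟨z, hz1, hz2, hz3⟩ := hcase l (δ / 2 / C) (by positivity)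
    obtain ⟨x, hx, hxz⟩ := hdist (T z) (δ / 2) (by positivity)
    refine ⟨z, hz1, hz2, x, hx, hxz.trans ?_⟩
    rw [lt_div_iff₀ hC] at hz3
    linarith

theorem seminorm_sum_le {E ι : Type*} [AddCommGroup E] [Module ℝ E] (q : Seminorm ℝ E)
    (s : Finset ι) (g : ι → E) : q (∑ i ∈ s, g i) ≤ ∑ i ∈ s, q (g i) :=
  Finset.le_sum_of_subadditive q (map_zero q).le (map_add_le_add q) s g

theorem exists_inf_seminorm {E : Type*} [AddCommGroup E] [Module ℝ E] (q : Seminorm ℝ E)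
    (M : Submodule ℝ E) : ∃ p : Seminorm ℝ E, (∀ e, ∀ m ∈ M, p e ≤ q (e + m)) ∧
      ∀ e ε, 0 < ε → ∃ m ∈ M, q (e + m) < p e + ε := by
  let f : E → ℝ := fun e => ⨅ m : M, q (e + m)
  have hbdd : ∀ e, BddBelow (Set.range fun m : M => q (e + m)) := fun e =>
    ⟨0, by rintro _ ⟨m, rfl⟩; exact apply_nonneg q _⟩
  have h1 : ∀ e, ∀ m ∈ M, f e ≤ q (e + m) := fun e m hm => ciInf_le (hbdd e) ⟨m, hm⟩
  have h2 : ∀ e ε, 0 < ε → ∃ m ∈ M, q (e + m) < f e + ε := by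
    intro e ε hε
    obtain ⟨m, hm⟩ := exists_lt_of_ciInf_lt (show ⨅ m : M, q (e + m) < f e + ε by
      change f e < _; linarith)
    exact ⟨m, m.2, hm⟩
  have h0 : f 0 = 0 := by
    refine le_antisymm ?_ (le_ciInf fun m => apply_nonneg q _)
    have := h1 0 0 M.zero_mem
    simpa using this
  refine ⟨Seminorm.ofSMulLE f h0 ?_ ?_, h1, h2⟩
  · intro x y
    refine le_of_forall_pos_le_add fun ε hε => ?_
    obtain ⟨m, hm, hm'⟩ := h2 x (ε / 2) (by positivity)
    obtain ⟨n, hn, hn'⟩ := h2 y (ε / 2) (by positivity)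
    have h3 := h1 (x + y) (m + n) (M.add_mem hm hn)
    have h4 := map_add_le_add q (x + m) (y + n)
    have h5 : x + y + (m + n) = x + m + (y + n) := by abel
    rw [h5] at h3
    linarith
  · intro r x
    rcases eq_or_ne r 0 with rfl | hr
    · simp [h0]
    have hr' : 0 < ‖r‖ := norm_pos_iff.mpr hr
    refine le_of_forall_pos_le_add fun ε hε => ?_
    obtain ⟨m, hm, hm'⟩ := h2 x (ε / ‖r‖) (by positivity)
    have h3 := h1 (r • x) (r • m) (M.smul_mem _ hm)
    rw [← smul_add, map_smul_eq_mul] at h3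
    refine h3.trans ?_
    have := mul_le_mul_of_nonneg_left hm'.le hr'.le
    rwa [mul_add, mul_div_cancel₀ _ hr'.ne'] at this

theorem exists_sum_seminorm {E : Type*} [AddCommGroup E] [Module ℝ E] (τ : ℕ → Seminorm ℝ E)
    (h : ∀ a, ∃ M, ∀ n ≥ M, τ n a = 0) : ∃ Θ : Seminorm ℝ E,
      (∀ a M, (∀ n ≥ M, τ n a = 0) → Θ a = ∑ n ∈ Finset.range M, τ n a) ∧
      ∀ a m, ∑ n ∈ Finset.range m, τ n a ≤ Θ a := by
  have hs : ∀ a M, (∀ n ≥ M, τ n a = 0) → HasSum (fun n => τ n a)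
      (∑ n ∈ Finset.range M, τ n a) := fun a M hM =>
    hasSum_sum_of_ne_finset_zero fun n hn => hM n (by simpa using hn)
  have hsm : ∀ a, Summable fun n => τ n a := fun a => by
    obtain ⟨M, hM⟩ := h a
    exact (hs a M hM).summable
  refine ⟨Seminorm.ofSMulLE (fun a => ∑' n, τ n a) (by simp) ?_ ?_,
    fun a M hM => (hs a M hM).tsum_eq,
    fun a m => (hsm a).sum_le_tsum _ (fun _ _ => apply_nonneg _ _)⟩
  · intro x y
    rw [← (hsm x).tsum_add (hsm y)]
    exact (hsm _).tsum_le_tsum (fun n => map_add_le_add _ _ _) ((hsm x).add (hsm y))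
  · intro r x
    rw [← tsum_mul_left]
    simp [map_smul_eq_mul]

theorem fin_lower (d : ℕ) (q : Seminorm ℝ (Fin d → ℝ)) (hq : ∀ c, q c = 0 → c = 0) :
    ∃ K : ℝ, 0 < K ∧ ∀ c, ‖c‖ ≤ K * q c := by
  have hb : ∀ c, q c ≤ (∑ i, q (Pi.single i 1)) * ‖c‖ := by
    intro c
    conv_lhs => rw [pi_eq_sum_univ' c]
    refine (seminorm_sum_le q _ _).trans ?_
    rw [Finset.sum_mul]
    refine Finset.sum_le_sum fun i _ => ?_
    rw [map_smul_eq_mul, mul_comm]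
    exact mul_le_mul_of_nonneg_left (norm_le_pi_norm c i) (apply_nonneg _ _)
  have hcont : Continuous q := by
    have hlip : LipschitzWith (Real.toNNReal (∑ i, q (Pi.single i 1))) q := by
      refine LipschitzWith.of_dist_le_mul fun x y => ?_
      rw [Real.dist_eq, dist_eq_norm, Real.coe_toNNReal _ (Finset.sum_nonneg fun _ _ => apply_nonneg _ _)]
      exact (abs_sub_map_le_sub q x y).trans (hb _)
    exact hlip.continuous
  rcases (Metric.sphere (0 : Fin d → ℝ) 1).eq_empty_or_nonempty with h | h
  · refine ⟨1, one_pos, fun c => ?_⟩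
    have : c = 0 := by
      by_contra hc
      have : (‖c‖)⁻¹ • c ∈ Metric.sphere (0 : Fin d → ℝ) 1 := by
        simp [norm_smul, inv_mul_cancel₀ (norm_ne_zero_iff.mpr hc)]
      rw [h] at this
      exact this
    simp [this]
  · obtain ⟨c0, hc0, hmin⟩ := (isCompact_sphere (0 : Fin d → ℝ) 1).exists_isMinOn h hcont.continuousOn
    have hpos : 0 < q c0 := by
      refine lt_of_le_of_ne (apply_nonneg _ _) fun h0 => ?_
      have := hq c0 h0.symm
      simp [this] at hc0
    refine ⟨(q c0)⁻¹, by positivity, fun c => ?_⟩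
    rcases eq_or_ne c 0 with rfl | hc
    · simp
    have hcn : 0 < ‖c‖ := norm_pos_iff.mpr hc
    have h1 : (‖c‖)⁻¹ • c ∈ Metric.sphere (0 : Fin d → ℝ) 1 := by
      simp [norm_smul, inv_mul_cancel₀ hcn.ne']
    have h2 : q c0 ≤ q ((‖c‖)⁻¹ • c) := hmin h1
    rw [map_smul_eq_mul, norm_inv, norm_norm] at h2
    rw [← div_eq_inv_mul, le_div_iff₀ hpos]
    rw [← div_eq_inv_mul, le_div_iff₀ hcn] at h2
    linarith

theorem finite_block {L : Type*} [AddCommGroup L] [Module ℝ L] (δ : Seminorm ℝ L)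
    (l : Finset (L →ₗ[ℝ] ℝ)) (hl : ∀ h, (∀ φ ∈ l, φ h = 0) → δ h = 0) :
    ∃ (d : ℕ) (u : ℕ → L) (f : ℕ → L →ₗ[ℝ] ℝ) (K : ℝ), 0 < d ∧ 0 < K ∧
      (∀ h, δ (h - ∑ i ∈ Finset.range d, f i h • u i) = 0) ∧
      (∀ h i, |f i h| * (δ (u i) + 1) ≤ K * δ h) := by
  classical
  let W : Submodule ℝ L :=
    { carrier := {h | δ h = 0}
      add_mem' := by
        intro a b ha hb
        have := map_add_le_add δ a b
        change δ a = 0 at ha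
        change δ b = 0 at hb
        rw [ha, hb] at this
        exact le_antisymm (by simpa using this) (apply_nonneg _ _)
      zero_mem' := map_zero δ
      smul_mem' := by
        intro r a ha
        change δ a = 0 at ha
        change δ (r • a) = 0
        rw [map_smul_eq_mul, ha, mul_zero] }
  let Λ : L →ₗ[ℝ] (l → ℝ) := LinearMap.pi fun φ => φ.1
  have hker : LinearMap.ker Λ ≤ W := fun h hh =>
    hl h fun φ hφ => congrFun (LinearMap.mem_ker.mp hh) ⟨φ, hφ⟩
  have hfd : FiniteDimensional ℝ (L ⧸ W) := by
    have h1 : FiniteDimensional ℝ (L ⧸ LinearMap.ker Λ) :=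
      Module.Finite.equiv Λ.quotKerEquivRange.symm
    exact Module.Finite.of_surjective (Submodule.factor hker) (Submodule.factor_surjective hker)
  let β := Module.finBasis ℝ (L ⧸ W)
  set d := Module.finrank ℝ (L ⧸ W) with hd
  have hlift : ∀ i, ∃ v : L, W.mkQ v = β i := fun i => W.mkQ_surjective _
  choose v hv using hlift
  let sumMap : (Fin d → ℝ) →ₗ[ℝ] L := Fintype.linearCombination ℝ v
  have hmk : ∀ c, W.mkQ (sumMap c) = ∑ i, c i • β i := by
    intro c
    simp only [sumMap, Fintype.linearCombination_apply, map_sum, map_smul, hv]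
  obtain ⟨K, hK, hKb⟩ := fin_lower d (δ.comp sumMap) (by
    intro c hc
    have h1 : sumMap c ∈ W := hc
    have h2 : W.mkQ (sumMap c) = 0 := by simpa using h1
    rw [hmk] at h2
    have := Fintype.linearIndependent_iff.mp β.linearIndependent c h2
    ext i; exact this i)
  have hsub : ∀ h : L, h - sumMap (fun i => β.coord i (W.mkQ h)) ∈ W := by
    intro h
    rw [← Submodule.Quotient.mk_eq_zero, ← Submodule.mkQ_apply, map_sub, hmk, sub_eq_zero]
    exact (β.sum_repr (W.mkQ h)).symm
  have hδeq : ∀ h, δ (sumMap (fun i => β.coord i (W.mkQ h))) = δ h := by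
    intro h
    have h1 : δ _ = 0 := hsub h
    have h2 := map_sub_le_add δ h (h - sumMap (fun i => β.coord i (W.mkQ h)))
    have h3 := map_add_le_add δ (sumMap (fun i => β.coord i (W.mkQ h))) (h - sumMap (fun i => β.coord i (W.mkQ h)))
    rw [add_sub_cancel] at h3
    rw [sub_sub_cancel] at h2
    linarith
  let u : ℕ → L := fun i => if hi : i < d then v ⟨i, hi⟩ else 0
  let f : ℕ → L →ₗ[ℝ] ℝ := fun i => if hi : i < d then (β.coord ⟨i, hi⟩).comp W.mkQ else 0
  refine ⟨d + 1, u, f, K * (∑ i, δ (v i) + 1), by omega, ?_, ?_, ?_⟩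
  · have : 0 ≤ ∑ i, δ (v i) := Finset.sum_nonneg fun _ _ => apply_nonneg _ _
    positivity
  · intro h
    have : ∑ i ∈ Finset.range (d + 1), f i h • u i = sumMap (fun i => β.coord i (W.mkQ h)) := by
      rw [Finset.sum_range_succ]
      have h1 : u d = 0 := by simp [u]
      rw [h1, smul_zero, add_zero, Finset.sum_range]
      simp only [sumMap, Fintype.linearCombination_apply]
      refine Finset.sum_congr rfl fun i _ => ?_
      simp [u, f]
    rw [this]
    exact hsub h
  · intro h i
    by_cases hi : i < d
    · have h1 : f i h = β.coord ⟨i, hi⟩ (W.mkQ h) := by simp [f, hi]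
      have h2 : u i = v ⟨i, hi⟩ := by simp [u, hi]
      have h3 := hKb (fun i => β.coord i (W.mkQ h))
      have h4 := norm_le_pi_norm (fun i => β.coord i (W.mkQ h)) ⟨i, hi⟩
      rw [Seminorm.comp_apply, hδeq] at h3
      have h5 : δ (v ⟨i, hi⟩) ≤ ∑ i, δ (v i) :=
        Finset.single_le_sum (f := fun i => δ (v i)) (fun _ _ => apply_nonneg _ _) (Finset.mem_univ _)
      rw [h1, h2]
      have h6 : |β.coord ⟨i, hi⟩ (W.mkQ h)| ≤ K * δ h := h4.trans h3
      calc _ ≤ (K * δ h) * (∑ i, δ (v i) + 1) := by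
            apply mul_le_mul h6 (by linarith)
            · have := apply_nonneg δ (v ⟨i, hi⟩); linarith
            · have := apply_nonneg δ h; positivity
        _ = _ := by ring
    · have h1 : f i h = 0 := by simp [f, hi]
      rw [h1, abs_zero, zero_mul]
      have := apply_nonneg δ h
      have : 0 ≤ ∑ i, δ (v i) := Finset.sum_nonneg fun _ _ => apply_nonneg _ _
      positivity

theorem sum_mod {E : Type*} [AddCommGroup E] [Module ℝ E] (g : ℕ → E) (d : ℕ) (q r : ℕ)
    (hr : r ≤ d) :
    ∑ j ∈ Finset.range (d * q + r), g (j % d) =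
      (q : ℝ) • ∑ i ∈ Finset.range d, g i + ∑ i ∈ Finset.range r, g i := by
  have hfull : ∀ q, ∑ j ∈ Finset.range (d * q), g (j % d) = (q : ℝ) • ∑ i ∈ Finset.range d, g i := by
    intro q
    induction q with
    | zero => simp
    | succ q ih =>
      rw [Nat.mul_succ, Finset.sum_range_add, ih]
      push_cast
      rw [add_smul, one_smul]
      congr 1
      refine Finset.sum_congr rfl fun i hi => ?_
      rw [Nat.mul_add_mod, Nat.mod_eq_of_lt (Finset.mem_range.mp hi)]
  rw [Finset.sum_range_add, hfull]
  congr 1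
  refine Finset.sum_congr rfl fun i hi => ?_
  rw [Nat.mul_add_mod, Nat.mod_eq_of_lt ((Finset.mem_range.mp hi).trans_le hr)]

/-- truncation -/
noncomputable def trunc (m : ℕ) (c : ℕ → ℝ) : ℕ → ℝ := fun i => if i < m then c i else 0

theorem block_lemma {L : Type*} [AddCommGroup L] [Module ℝ L] (δ : Seminorm ℝ L)
    (l : Finset (L →ₗ[ℝ] ℝ)) (hl : ∀ h, (∀ φ ∈ l, φ h = 0) → δ h = 0) :
    ∃ (M : ℕ) (T : (ℕ → ℝ) →ₗ[ℝ] L) (S : L →ₗ[ℝ] (ℕ → ℝ)) (nu : Seminorm ℝ (ℕ → ℝ)),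
      0 < M ∧
      (∀ c, (∀ i < M, c i = 0) → T c = 0 ∧ nu c = 0) ∧
      (∀ c, δ (T c) ≤ nu c) ∧
      (∀ h, nu (S h) ≤ 3 * δ h) ∧
      (∀ h, δ (T (S h) - h) = 0) ∧
      (∀ c m, nu (trunc m c) ≤ nu c) ∧
      (∀ c, ∀ i < M, |c i| ≤ nu c) := by
  classical
  obtain ⟨d, u, f, K, hd, hK, hf1, hf2⟩ := finite_block δ l hl
  obtain ⟨R, hR⟩ := exists_nat_ge (d * K + 1)
  have hd1 : (1:ℝ) ≤ d := by exact_mod_cast hd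
  have hRK : K ≤ R := by nlinarith
  have hRpos : (0:ℝ) < R := by linarith
  let part : ℕ → (ℕ → ℝ) →ₗ[ℝ] L := fun m =>
    ∑ j ∈ Finset.range m, (LinearMap.proj j : (ℕ → ℝ) →ₗ[ℝ] ℝ).smulRight (u (j % d))
  have hpart : ∀ m c, part m c = ∑ j ∈ Finset.range m, c j • u (j % d) := by
    intro m c
    simp [part]
  let S : L →ₗ[ℝ] (ℕ → ℝ) := LinearMap.pi fun j => (R : ℝ)⁻¹ • f (j % d)
  have hS : ∀ h j, S h j = (R : ℝ)⁻¹ * f (j % d) h := fun h j => rfl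
  let nu1 : Seminorm ℝ (ℕ → ℝ) := (Finset.range (d * R + 1)).sup fun m => δ.comp (part m)
  let nu2 : Seminorm ℝ (ℕ → ℝ) := (Finset.range (d * R)).sup fun i =>
    (normSeminorm ℝ ℝ).comp (LinearMap.proj i)
  have hnu1 : ∀ c m, m ≤ d * R → δ (part m c) ≤ nu1 c := fun c m hm =>
    Seminorm.le_finset_sup_apply (p := fun m => δ.comp (part m)) (Finset.mem_range.mpr (by omega))
  have hnu2 : ∀ c i, i < d * R → |c i| ≤ nu2 c := fun c i hi =>
    Seminorm.le_finset_sup_apply (p := fun i =>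
      (normSeminorm ℝ ℝ).comp (LinearMap.proj (φ := fun _ : ℕ => ℝ) i)) (Finset.mem_range.mpr hi)
  have hsS : ∀ h m, part m (S h) = (R:ℝ)⁻¹ • ∑ j ∈ Finset.range m, f (j % d) h • u (j % d) := by
    intro h m
    rw [hpart, Finset.smul_sum]
    refine Finset.sum_congr rfl fun j _ => ?_
    rw [hS, smul_smul]
  have hδs : ∀ h, δ (∑ i ∈ Finset.range d, f i h • u i) ≤ δ h := by
    intro h
    have h2 := map_sub_le_add δ h (h - ∑ i ∈ Finset.range d, f i h • u i)
    rw [sub_sub_cancel, hf1] at h2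
    linarith
  refine ⟨d * R, part (d * R), S, nu1 + nu2, ?_, ?_, ?_, ?_, ?_, ?_, ?_⟩
  · have : 0 < R := by exact_mod_cast hRpos
    positivity
  · intro c hc
    have h0 : ∀ m ≤ d * R, part m c = 0 := by
      intro m hm
      rw [hpart]
      refine Finset.sum_eq_zero fun j hj => ?_
      rw [hc j ((Finset.mem_range.mp hj).trans_le hm), zero_smul]
    refine ⟨h0 _ le_rfl, ?_⟩
    have h1 : nu1 c ≤ 0 := Seminorm.finset_sup_apply_le le_rfl fun m hm => by
      rw [Seminorm.comp_apply, h0 m (by have := Finset.mem_range.mp hm; omega), map_zero]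
    have h2 : nu2 c ≤ 0 := Seminorm.finset_sup_apply_le le_rfl fun i hi => by
      change ‖c i‖ ≤ 0
      rw [hc i (Finset.mem_range.mp hi), norm_zero]
    rw [add_apply]
    have := apply_nonneg nu1 c
    have := apply_nonneg nu2 c
    linarith
  · intro c
    rw [add_apply]
    have := apply_nonneg nu2 c
    have := hnu1 c (d * R) le_rfl
    linarith
  · intro h
    have hδ := apply_nonneg δ h
    rw [add_apply]
    have h1 : nu1 (S h) ≤ 2 * δ h := by
      refine Seminorm.finset_sup_apply_le (by positivity) fun m hm => ?_
      rw [Seminorm.comp_apply, hsS, map_smul_eq_mul, norm_inv, Real.norm_of_nonneg hRpos.le,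
        ← div_eq_inv_mul, div_le_iff₀ hRpos]
      have hm' : m ≤ d * R := by have := Finset.mem_range.mp hm; omega
      have hq : m / d ≤ R := by
        rw [Nat.div_le_iff_le_mul_add_pred hd]; omega
      have hq' : ((m / d : ℕ) : ℝ) ≤ R := by exact_mod_cast hq
      rw [← Nat.div_add_mod m d, sum_mod (fun i => f i h • u i) d _ _ (Nat.mod_lt _ hd).le]
      refine (map_add_le_add δ _ _).trans ?_
      rw [map_smul_eq_mul, Real.norm_of_nonneg (by positivity)]
      have h3 : δ (∑ i ∈ Finset.range (m % d), f i h • u i) ≤ d * (K * δ h) := by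
        refine (seminorm_sum_le δ _ _).trans ?_
        calc _ ≤ ∑ i ∈ Finset.range (m % d), K * δ h := by
              refine Finset.sum_le_sum fun i _ => ?_
              rw [map_smul_eq_mul, Real.norm_eq_abs]
              have := hf2 h i
              have := abs_nonneg (f i h)
              linarith
          _ = (m % d : ℕ) * (K * δ h) := by simp
          _ ≤ _ := by
              have : ((m % d : ℕ) : ℝ) ≤ d := by exact_mod_cast (Nat.mod_lt _ hd).le
              exact mul_le_mul_of_nonneg_right this (by positivity)
      have h4 : ((m / d : ℕ) : ℝ) * δ (∑ i ∈ Finset.range d, f i h • u i) ≤ R * δ h :=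
        mul_le_mul hq' (hδs h) (apply_nonneg _ _) hRpos.le
      nlinarith
    have h2 : nu2 (S h) ≤ δ h := by
      refine Seminorm.finset_sup_apply_le hδ fun i _ => ?_
      change ‖S h i‖ ≤ _
      rw [hS, norm_mul, norm_inv, Real.norm_of_nonneg hRpos.le, ← div_eq_inv_mul,
        div_le_iff₀ hRpos, Real.norm_eq_abs]
      have h3 := hf2 h (i % d)
      have h4 : 0 ≤ |f (i % d) h| * δ (u (i % d)) := mul_nonneg (abs_nonneg _) (apply_nonneg _ _)
      nlinarith
    linarith
  · intro h
    have h1 : part (d * R) (S h) = ∑ i ∈ Finset.range d, f i h • u i := by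
      rw [hsS]
      have := sum_mod (fun i => f i h • u i) d R 0 (by omega)
      rw [add_zero] at this
      rw [this, Finset.sum_range_zero, add_zero, smul_smul, inv_mul_cancel₀ hRpos.ne', one_smul]
    rw [h1, map_sub_rev, hf1]
  · intro c m
    rw [add_apply, add_apply]
    have h1 : nu1 (trunc m c) ≤ nu1 c := by
      refine Seminorm.finset_sup_apply_le (apply_nonneg _ _) fun k hk => ?_
      have hk' : k ≤ d * R := by have := Finset.mem_range.mp hk; omega
      have : part k (trunc m c) = part (min k m) c := by
        rw [hpart, hpart, ← Finset.sum_subset (Finset.range_mono (min_le_left k m))]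
        · refine Finset.sum_congr rfl fun j hj => ?_
          have : j < m := by have := Finset.mem_range.mp hj; omega
          simp [trunc, this]
        · intro j hj hj'
          have h1 := Finset.mem_range.mp hj
          have : ¬ j < m := by
            intro h2; exact hj' (Finset.mem_range.mpr (by omega))
          simp [trunc, this]
      rw [Seminorm.comp_apply, this]
      exact hnu1 c _ (by omega)
    have h2 : nu2 (trunc m c) ≤ nu2 c := by
      refine Seminorm.finset_sup_apply_le (apply_nonneg _ _) fun i hi => ?_
      change ‖trunc m c i‖ ≤ _
      refine le_trans ?_ (hnu2 c i (Finset.mem_range.mp hi))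
      unfold trunc
      split_ifs
      · rfl
      · simp
    linarith
  · intro c i hi
    rw [add_apply]
    have := apply_nonneg nu1 c
    have := hnu2 c i hi
    linarith

theorem seminorm_eq_of_sub {E : Type*} [AddCommGroup E] [Module ℝ E] (q : Seminorm ℝ E)
    {a b : E} (h : q (a - b) = 0) : q a = q b := by
  have := abs_sub_map_le_sub q a b
  rw [h] at this
  exact sub_eq_zero.mp (abs_eq_zero.mp (le_antisymm this (abs_nonneg _)))

theorem pel {V L : Type*} [AddCommGroup V] [Module ℝ V] [AddCommGroup L] [Module ℝ L]
    (N₁ : Seminorm ℝ V) (D : ℕ → L →ₗ[ℝ] V) (Q : ℕ → V →ₗ[ℝ] V)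
    (hQ : ∀ n v, N₁ (Q n v) ≤ 2 * N₁ v)
    (hQD1 : ∀ n k h, k < n → Q n (D k h) = D k h)
    (hQD2 : ∀ n k h, n ≤ k → Q n (D k h) = 0)
    (l : ℕ → Finset (L →ₗ[ℝ] ℝ)) (hl : ∀ n h, (∀ φ ∈ l n, φ h = 0) → N₁ (D n h) = 0) :
    ∃ (Φ : (ℕ →₀ ℝ) →ₗ[ℝ] V) (τ : ℕ → Seminorm ℝ (ℕ →₀ ℝ)) (Θ : Seminorm ℝ (ℕ →₀ ℝ)),
      (∀ a, ∃ M, ∀ m ≥ M, Θ a = ∑ n ∈ Finset.range m, τ n a) ∧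
      (∀ a m, ∑ n ∈ Finset.range m, τ n a ≤ Θ a) ∧
      (∀ a m, N₁ (Φ (a.filter (· < m))) + Θ (a.filter (· < m)) ≤ 62 * (N₁ (Φ a) + Θ a)) ∧
      (∀ j, 0 < N₁ (Φ (Finsupp.single j 1)) + Θ (Finsupp.single j 1)) ∧
      (∀ n, ∃ M, ∀ j ≥ M, τ n (Finsupp.single j 1) = 0) ∧
      (∀ n, ∃ M, ∀ j ≥ M, ∃ k ≥ n, ∃ h, Φ (Finsupp.single j 1) = D k h) ∧
      (∀ n h, ∃ ξ, N₁ (Φ ξ - D n h) = 0 ∧ Θ ξ = 0) := by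
  classical
  have hblk := fun n => block_lemma (N₁.comp (D n)) (l n) (hl n)
  choose M T S nu hM hvan hTnu hS hTS htr hco using hblk
  let b : ℕ → ℕ := fun n => ∑ k ∈ Finset.range n, M k
  have hb1 : ∀ n, b (n + 1) = b n + M n := fun n => Finset.sum_range_succ _ _
  have hbmono : StrictMono b := strictMono_nat_of_lt_succ fun n => by
    rw [hb1]; have := hM n; omega
  have hbge : ∀ n, n ≤ b n := fun n => hbmono.id_le n
  have hloc : ∀ j, ∃ n i, i < M n ∧ j = b n + i := by
    intro j
    induction j with
    | zero => exact ⟨0, 0, hM 0, by simp [b]⟩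
    | succ j ih =>
      obtain ⟨n, i, hi, hj⟩ := ih
      by_cases h : i + 1 < M n
      · exact ⟨n, i + 1, h, by omega⟩
      · exact ⟨n + 1, 0, hM _, by rw [hb1]; omega⟩
  have huniq : ∀ n i n' i', i < M n → i' < M n' → b n + i = b n' + i' → n = n' ∧ i = i' := by
    intro n i n' i' hi hi' h
    have hn : n = n' := by
      rcases lt_trichotomy n n' with h1 | h1 | h1
      · have := hbmono.monotone (show n + 1 ≤ n' by omega)
        rw [hb1] at this; omega
      · exact h1
      · have := hbmono.monotone (show n' + 1 ≤ n by omega)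
        rw [hb1] at this; omega
    subst hn
    exact ⟨rfl, by omega⟩
  choose kk ii hii hji using hloc
  have hkk : ∀ n i, i < M n → kk (b n + i) = n ∧ ii (b n + i) = i := fun n i hi =>
    huniq _ _ _ _ (hii _) hi (hji _).symm
  let r : ℕ → (ℕ →₀ ℝ) →ₗ[ℝ] (ℕ → ℝ) := fun n => LinearMap.pi fun i => Finsupp.lapply (b n + i)
  have hr : ∀ n a i, r n a i = a (b n + i) := fun n a i => rfl
  let Φ : (ℕ →₀ ℝ) →ₗ[ℝ] V := Finsupp.linearCombination ℝ fun j =>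
    D (kk j) (T (kk j) (Pi.single (ii j) 1))
  have hΦs : ∀ j, Φ (Finsupp.single j 1) = D (kk j) (T (kk j) (Pi.single (ii j) 1)) := fun j => by
    simp [Φ]
  have hΦ : ∀ m a, (∀ j ≥ b m, a j = 0) → Φ a = ∑ n ∈ Finset.range m, D n (T n (r n a)) := by
    intro m a ha
    let Ψ : (ℕ →₀ ℝ) →ₗ[ℝ] V := ∑ n ∈ Finset.range m, (D n).comp ((T n).comp (r n))
    have hΨ : ∀ a, Ψ a = ∑ n ∈ Finset.range m, D n (T n (r n a)) := fun a => by simp [Ψ]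
    rw [← hΨ]
    have h1 : a = ∑ j ∈ Finset.range (b m), a j • Finsupp.single j (1:ℝ) := by
      have h2 : a.filter (· < b m) = a := by
        rw [Finsupp.filter_eq_self_iff]
        intro i hi
        by_contra h
        exact hi (ha i (by omega))
      conv_lhs => rw [← h2, filter_lt_eq]
      simp
    rw [h1, map_sum, map_sum]
    refine Finset.sum_congr rfl fun j hj => ?_
    rw [map_smul, map_smul, hΦs, hΨ]
    congr 1
    have hkj : kk j < m := by
      have h2 := Finset.mem_range.mp hj
      have h3 := hji j
      by_contra h
      have := hbmono.monotone (show m ≤ kk j by omega)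
      omega
    rw [Finset.sum_eq_single (kk j)]
    · congr 2
      ext i
      rw [hr, Pi.single_apply, Finsupp.single_apply]
      have := hji j
      congr 1
      apply propext
      constructor <;> intro h <;> omega
    · intro n _ hn
      rw [(hvan n _ _).1, map_zero]
      intro i hi
      rw [hr, Finsupp.single_apply, if_neg]
      intro h
      apply hn
      rw [h]
      exact (hkk n i hi).1.symm
    · intro h
      exact absurd (Finset.mem_range.mpr hkj) h
  let τ : ℕ → Seminorm ℝ (ℕ →₀ ℝ) := fun n =>
    (nu n).comp (r n - (S n).comp ((T n).comp (r n)))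
  have hτ : ∀ n a, τ n a = nu n (r n a - S n (T n (r n a))) := fun n a => rfl
  have hτ0 : ∀ n a, (∀ i < M n, a (b n + i) = 0) → τ n a = 0 := by
    intro n a ha
    obtain ⟨h1, h2⟩ := hvan n (r n a) ha
    rw [hτ, h1, map_zero, sub_zero, h2]
  have hsupp : ∀ a : ℕ →₀ ℝ, ∃ m, ∀ n ≥ m, ∀ j ≥ b n, a j = 0 := by
    intro a
    refine ⟨a.support.sup id + 1, fun n hn j hj => ?_⟩
    by_contra h
    have h1 : j ≤ a.support.sup id := Finset.le_sup (f := id) (Finsupp.mem_support_iff.mpr h)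
    have := hbge n
    omega
  have hτsupp : ∀ m a, (∀ j ≥ b m, a j = 0) → ∀ n ≥ m, τ n a = 0 := by
    intro m a ha n hn
    refine hτ0 n a fun i hi => ha _ ?_
    have := hbmono.monotone hn
    omega
  obtain ⟨Θ, hΘ1, hΘ2⟩ := exists_sum_seminorm τ (fun a => by
    obtain ⟨m, hm⟩ := hsupp a
    exact ⟨m, hτsupp m a (hm m le_rfl)⟩)
  have hQΦ : ∀ n a, Q n (Φ a) = ∑ k ∈ Finset.range n, D k (T k (r k a)) := by
    intro n a
    obtain ⟨m, hm⟩ := hsupp a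
    rw [hΦ (m + n) a (hm _ (by omega)), map_sum,
      ← Finset.sum_subset (Finset.range_mono (show n ≤ m + n by omega))]
    · exact Finset.sum_congr rfl fun k hk => hQD1 _ _ _ (Finset.mem_range.mp hk)
    · intro k _ hk
      exact hQD2 _ _ _ (by simpa using hk)
  have hδ : ∀ n a, N₁ (D n (T n (r n a))) ≤ 4 * N₁ (Φ a) := by
    intro n a
    have h1 : D n (T n (r n a)) = Q (n + 1) (Φ a) - Q n (Φ a) := by
      rw [hQΦ, hQΦ, Finset.sum_range_succ, add_sub_cancel_left]
    rw [h1]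
    have := map_sub_le_add N₁ (Q (n + 1) (Φ a)) (Q n (Φ a))
    have := hQ (n + 1) (Φ a)
    have := hQ n (Φ a)
    linarith
  have hτΘ : ∀ n a, τ n a ≤ Θ a := by
    intro n a
    refine le_trans ?_ (hΘ2 a (n + 1))
    exact Finset.single_le_sum (f := fun n => τ n a) (fun _ _ => apply_nonneg _ _)
      (Finset.mem_range.mpr (by omega))
  have hnur : ∀ n a, nu n (r n a) ≤ 12 * (N₁ (Φ a) + Θ a) := by
    intro n a
    have h1 := map_add_le_add (nu n) (r n a - S n (T n (r n a))) (S n (T n (r n a)))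
    rw [sub_add_cancel, ← hτ] at h1
    have h2 : nu n (S n (T n (r n a))) ≤ 3 * N₁ (D n (T n (r n a))) := hS n _
    have h3 := hδ n a
    have h4 := hτΘ n a
    have h5 := apply_nonneg Θ a
    linarith
  refine ⟨Φ, τ, Θ, ?_, hΘ2, ?_, ?_, ?_, ?_, ?_⟩
  · intro a
    obtain ⟨m, hm⟩ := hsupp a
    exact ⟨m, fun n hn => hΘ1 a n (hτsupp n a (hm n hn))⟩
  · intro a m
    set a' := a.filter (· < m) with ha'
    have ha'a : ∀ j, a' j = if j < m then a j else 0 := fun j => Finsupp.filter_apply _ _ _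
    set n := kk m with hn
    set i := ii m with hi
    have hm : m = b n + i := hji m
    have him : i < M n := hii m
    have hs : ∀ j ≥ b (n + 1), a' j = 0 := by
      intro j hj
      rw [hb1] at hj
      rw [ha'a, if_neg (by omega)]
    have hlow : ∀ k < n, ∀ i' < M k, (a' - a) (b k + i') = 0 := by
      intro k hk i' hi'
      have := hbmono.monotone (show k + 1 ≤ n by omega)
      rw [hb1] at this
      rw [Finsupp.sub_apply, ha'a, if_pos (by omega), sub_self]
    have hrn : r n a' = trunc i (r n a) := by
      ext i'
      rw [hr, ha'a, trunc, hr]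
      congr 1
      apply propext
      constructor <;> intro h <;> omega
    have hTk : ∀ k < n, T k (r k a') = T k (r k a) := by
      intro k hk
      have h1 := (hvan k (r k (a' - a)) (hlow k hk)).1
      rw [map_sub, map_sub, sub_eq_zero] at h1
      exact h1
    have hΦa' : Φ a' = Q n (Φ a) + D n (T n (r n a')) := by
      rw [hΦ (n + 1) a' hs, Finset.sum_range_succ, hQΦ]
      congr 1
      exact Finset.sum_congr rfl fun k hk => by rw [hTk k (Finset.mem_range.mp hk)]
    have hΘa' : Θ a' ≤ Θ a + τ n a' := by
      rw [hΘ1 a' (n + 1) (hτsupp _ _ hs), Finset.sum_range_succ]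
      have h1 : ∑ k ∈ Finset.range n, τ k a' = ∑ k ∈ Finset.range n, τ k a :=
        Finset.sum_congr rfl fun k hk => seminorm_eq_of_sub _
          (hτ0 k _ (hlow k (Finset.mem_range.mp hk)))
      have := hΘ2 a n
      linarith
    have h1 : nu n (r n a') ≤ 12 * (N₁ (Φ a) + Θ a) := by
      rw [hrn]; exact (htr n _ _).trans (hnur n a)
    have h2 : N₁ (D n (T n (r n a'))) ≤ nu n (r n a') := hTnu n _
    have h3 : τ n a' ≤ nu n (r n a') + 3 * N₁ (D n (T n (r n a'))) := by
      rw [hτ]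
      refine (map_sub_le_add _ _ _).trans ?_
      have : nu n (S n (T n (r n a'))) ≤ 3 * N₁ (D n (T n (r n a'))) := hS n _
      linarith
    have h4 := map_add_le_add N₁ (Q n (Φ a)) (D n (T n (r n a')))
    rw [← hΦa'] at h4
    have h5 := hQ n (Φ a)
    have h6 := apply_nonneg Θ a
    linarith
  · intro j
    have h1 := hnur (kk j) (Finsupp.single j 1)
    have h2 := hco (kk j) (r (kk j) (Finsupp.single j 1)) (ii j) (hii j)
    rw [hr, ← hji j, Finsupp.single_eq_same, abs_one] at h2
    linarith
  · intro n
    refine ⟨b (n + 1), fun j hj => hτ0 n _ fun i hi => ?_⟩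
    rw [hb1] at hj
    rw [Finsupp.single_apply, if_neg (by omega)]
  · intro n
    refine ⟨b n, fun j hj => ⟨kk j, ?_, _, hΦs j⟩⟩
    by_contra h
    have := hbmono.monotone (show kk j + 1 ≤ n by omega)
    rw [hb1] at this
    have := hji j
    have := hii j
    omega
  · intro n h
    let ξ : ℕ →₀ ℝ := Finsupp.onFinset (Finset.range (b (n + 1)))
      (fun j => if kk j = n then S n h (ii j) else 0) (by
        intro j hj
        have hj' : kk j = n := by
          by_contra h'
          simp [h'] at hj
        have h1 := hji j
        have h2 := hii j
        rw [hj'] at h1 h2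
        rw [Finset.mem_range, hb1]
        omega)
    have hξ : ∀ k i, i < M k → ξ (b k + i) = if k = n then S n h i else 0 := by
      intro k i hi
      obtain ⟨h1, h2⟩ := hkk k i hi
      simp only [ξ, Finsupp.onFinset_apply, h1, h2]
    have hξs : ∀ j ≥ b (n + 1), ξ j = 0 := by
      intro j hj
      by_contra hne
      have : j ∈ Finset.range (b (n + 1)) :=
        Finsupp.support_onFinset_subset (Finsupp.mem_support_iff.mpr hne)
      have := Finset.mem_range.mp this
      omega
    have hdiff : ∀ i < M n, (r n ξ - S n h) i = 0 := by
      intro i hi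
      rw [Pi.sub_apply, hr, hξ n i hi, if_pos rfl, sub_self]
    obtain ⟨hd1, hd2⟩ := hvan n _ hdiff
    have hTξ : T n (r n ξ) = T n (S n h) := by
      rw [map_sub, sub_eq_zero] at hd1; exact hd1
    have hTS' : N₁ (D n (T n (S n h) - h)) = 0 := hTS n h
    refine ⟨ξ, ?_, ?_⟩
    · rw [hΦ (n + 1) ξ hξs, Finset.sum_eq_single n]
      · rw [hTξ, ← map_sub]
        exact hTS'
      · intro k _ hk
        rw [(hvan k _ fun i hi => _).1, map_zero]
        intro i hi
        rw [hr, hξ k i hi, if_neg hk]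
      · intro h; exact absurd (Finset.mem_range.mpr (by omega)) h
    · rw [hΘ1 ξ (n + 1) (hτsupp _ _ hξs)]
      refine Finset.sum_eq_zero fun k _ => ?_
      by_cases hk : k = n
      · subst hk
        rw [hτ, hTξ]
        have h1 := map_sub_le_add (nu k) (r k ξ - S k h) (S k (T k (S k h) - h))
        have h2 : r k ξ - S k h - S k (T k (S k h) - h) = r k ξ - S k (T k (S k h)) := by
          rw [map_sub]; abel
        have h3 : nu k (S k (T k (S k h) - h)) ≤ 3 * N₁ (D k (T k (S k h) - h)) := hS k _
        rw [h2, hd2] at h1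
        rw [hTS'] at h3
        have := apply_nonneg (nu k) (r k ξ - S k (T k (S k h)))
        linarith
      · exact hτ0 k ξ fun i hi => by rw [hξ k i hi, if_neg hk]

theorem norming_finset {L : Type*} [NormedAddCommGroup L] [NormedSpace ℝ L]
    (S : Submodule ℝ L) [FiniteDimensional ℝ S] :
    ∃ A : Finset (L →L[ℝ] ℝ), (∀ φ ∈ A, ‖φ‖ ≤ 1) ∧
      ∀ s ∈ S, s ≠ 0 → ∃ φ ∈ A, ‖s‖ ≤ 2 * |φ s| := by
  classical
  have hproper : ProperSpace S := FiniteDimensional.proper ℝ S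
  have hex : ∀ s : S, ∃ φ : L →L[ℝ] ℝ, ‖φ‖ ≤ 1 ∧ φ s = ‖s‖ := fun s =>
    exists_dual_vector'' ℝ (s : L)
  choose φ hφ1 hφ2 using hex
  obtain ⟨t, ht⟩ := (isCompact_sphere (0 : S) 1).elim_finite_subcover
    (fun s : S => {y : S | 1 / 2 < |φ s y|})
    (fun s => isOpen_lt continuous_const (by fun_prop))
    (by
      intro s hs
      have hs1 : ‖s‖ = 1 := by simpa using hs
      refine Set.mem_iUnion.mpr ⟨s, ?_⟩
      change 1 / 2 < |φ s s|
      rw [hφ2, hs1]; norm_num)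
  refine ⟨t.image φ, ?_, ?_⟩
  · intro ψ hψ
    obtain ⟨s, _, rfl⟩ := Finset.mem_image.mp hψ
    exact hφ1 s
  · intro s hs hs0
    have hpos : 0 < ‖s‖ := norm_pos_iff.mpr hs0
    let y : S := (‖s‖)⁻¹ • ⟨s, hs⟩
    have hy : y ∈ Metric.sphere (0 : S) 1 := by
      have : ‖y‖ = 1 := by
        change ‖(‖s‖)⁻¹ • s‖ = 1
        rw [norm_smul, norm_inv, norm_norm, inv_mul_cancel₀ hpos.ne']
      simpa using this
    obtain ⟨s', hs', hlt⟩ := Set.mem_iUnion₂.mp (ht hy)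
    refine ⟨φ s', Finset.mem_image_of_mem _ hs', ?_⟩
    have h1 : 1 / 2 < |φ s' ((‖s‖)⁻¹ • s)| := hlt
    rw [map_smul, smul_eq_mul, abs_mul, abs_inv, abs_norm, ← div_eq_inv_mul,
      lt_div_iff₀ hpos] at h1
    linarith

theorem norming_seq {L : Type*} [NormedAddCommGroup L] [NormedSpace ℝ L]
    (S : ℕ → Submodule ℝ L) (hS : ∀ n, FiniteDimensional ℝ (S n)) :
    ∃ (p : ℕ → Seminorm ℝ L) (l : ℕ → Finset (L →ₗ[ℝ] ℝ)),
      (∀ n m h, n ≤ m → p n h ≤ p m h) ∧ (∀ n h, p n h ≤ 2 * ‖h‖) ∧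
      (∀ n, ∀ s ∈ S n, ‖s‖ ≤ p n s) ∧ (∀ n h, (∀ φ ∈ l n, φ h = 0) → p n h = 0) := by
  classical
  choose B hB1 hB2 using fun n => norming_finset (S n)
  let A : ℕ → Finset (L →L[ℝ] ℝ) := fun n => (Finset.range (n + 1)).biUnion B
  let P : (L →L[ℝ] ℝ) → Seminorm ℝ L := fun φ =>
    (normSeminorm ℝ ℝ).comp ((2:ℝ) • (φ : L →ₗ[ℝ] ℝ))
  have hP : ∀ φ h, P φ h = 2 * |φ h| := by
    intro φ h
    change ‖(2:ℝ) • φ h‖ = _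
    rw [norm_smul, Real.norm_eq_abs, Real.norm_eq_abs, abs_two]
  refine ⟨fun n => (A n).sup P, fun n => (A n).image (fun φ : L →L[ℝ] ℝ => φ.toLinearMap), ?_, ?_, ?_, ?_⟩
  · intro n m h hnm
    have : A n ⊆ A m := Finset.biUnion_subset_biUnion_of_subset_left _
      (Finset.range_mono (by omega))
    exact Finset.sup_mono (f := P) this h
  · intro n h
    refine Seminorm.finset_sup_apply_le (by positivity) fun φ hφ => ?_
    rw [hP]
    obtain ⟨k, _, hk⟩ := Finset.mem_biUnion.mp hφ
    have h1 := φ.le_opNorm h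
    have h2 := mul_le_of_le_one_left (norm_nonneg h) (hB1 k φ hk)
    rw [Real.norm_eq_abs] at h1
    linarith
  · intro n s hs
    rcases eq_or_ne s 0 with rfl | hs0
    · simp
    obtain ⟨φ, hφ, hle⟩ := hB2 n s hs hs0
    refine hle.trans ?_
    rw [← hP]
    exact Seminorm.le_finset_sup_apply (Finset.mem_biUnion.mpr ⟨n, by simp, hφ⟩)
  · intro n h hh
    refine le_antisymm (Seminorm.finset_sup_apply_le le_rfl fun φ hφ => ?_) (apply_nonneg _ _)
    have : φ h = 0 := hh φ.toLinearMap (Finset.mem_image_of_mem (fun φ : L →L[ℝ] ℝ => φ.toLinearMap) hφ)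
    rw [hP, this, abs_zero, mul_zero]

theorem seminorm_lc_zero {E : Type*} [AddCommGroup E] [Module ℝ E] (q : Seminorm ℝ E)
    (y : ℕ → E) (hy : ∀ i, q (y i) = 0) (b : ℕ →₀ ℝ) :
    q (Finsupp.linearCombination ℝ y b) = 0 := by
  refine le_antisymm ?_ (apply_nonneg _ _)
  rw [Finsupp.linearCombination_apply, Finsupp.sum]
  refine (seminorm_sum_le q _ _).trans (Finset.sum_nonpos fun i _ => ?_)
  rw [map_smul_eq_mul, hy, mul_zero]

theorem stage_one {L : Type*} [NormedAddCommGroup L] [NormedSpace ℝ L] (x : ℕ → L) :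
    ∃ (N₁ : Seminorm ℝ (ℕ →₀ L)) (σ : ℕ → Seminorm ℝ (ℕ →₀ L))
      (D : ℕ → L →ₗ[ℝ] (ℕ →₀ L)) (Q : ℕ → (ℕ →₀ L) →ₗ[ℝ] (ℕ →₀ L))
      (l : ℕ → Finset (L →ₗ[ℝ] ℝ)),
      (∀ n v, N₁ (Q n v) ≤ 2 * N₁ v) ∧
      (∀ n k h, k < n → Q n (D k h) = D k h) ∧
      (∀ n k h, n ≤ k → Q n (D k h) = 0) ∧
      (∀ n h, (∀ φ ∈ l n, φ h = 0) → N₁ (D n h) = 0) ∧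
      (∀ n h, ∑ k ∈ Finset.range (n + 1), D k h = Finsupp.single n h) ∧
      (∀ b, N₁ (Finsupp.linearCombination ℝ (fun i => Finsupp.single (i + 1) (x i)) b)
        = ‖Finsupp.linearCombination ℝ x b‖) ∧
      (∀ v m, ∑ n ∈ Finset.range m, σ n v ≤ N₁ v) ∧
      (∀ n k h, n + 2 ≤ k → σ n (D k h) = 0) ∧
      (∀ v ε, 0 < ε → ∃ b m, ∀ m' ≥ m,
        N₁ (v - Finsupp.linearCombination ℝ (fun i => Finsupp.single (i + 1) (x i)) b)
        ≤ ∑ n ∈ Finset.range m', σ n v + ε) := by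
  classical
  let S : ℕ → Submodule ℝ L := fun n => Submodule.span ℝ (x '' Set.Iio n)
  have hSmono : ∀ n m, n ≤ m → S n ≤ S m := fun n m h =>
    Submodule.span_mono (Set.image_mono (Set.Iio_subset_Iio h))
  have hxS : ∀ i, x i ∈ S (i + 1) := fun i =>
    Submodule.subset_span ⟨i, by simp, rfl⟩
  obtain ⟨p, l, hpm, hp2, hpS, hpl⟩ := norming_seq S
    (fun n => FiniteDimensional.span_of_finite ℝ ((Set.finite_Iio n).image x))
  have hrng : ∀ g : ℕ →₀ L, ∃ m, ∀ k ≥ m, ∀ n ≥ k, g n = 0 := by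
    intro g
    refine ⟨g.support.sup id + 1, fun k hk n hn => ?_⟩
    by_contra h
    have h1 : n ≤ g.support.sup id := Finset.le_sup (f := id) (Finsupp.mem_support_iff.mpr h)
    omega
  have hgsum : ∀ (g : ℕ →₀ L) m, (∀ n ≥ m, g n = 0) →
      g = ∑ n ∈ Finset.range m, Finsupp.single n (g n) := by
    intro g m hm
    ext i
    rw [Finsupp.finsetSum_apply]
    simp only [Finsupp.single_apply, Finset.sum_ite_eq', Finset.mem_range]
    split_ifs with h
    · rfl
    · exact hm i (by omega)
  let tot : (ℕ →₀ L) →ₗ[ℝ] L := Finsupp.lsum ℝ fun _ => LinearMap.id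
  have htots : ∀ n h, tot (Finsupp.single n h) = h := fun n h => by simp [tot]
  have htot : ∀ (g : ℕ →₀ L) m, (∀ n ≥ m, g n = 0) → tot g = ∑ n ∈ Finset.range m, g n := by
    intro g m hm
    conv_lhs => rw [hgsum g m hm]
    rw [map_sum]
    exact Finset.sum_congr rfl fun n _ => htots _ _
  obtain ⟨W, hW1, hW2⟩ := exists_sum_seminorm
    (fun n => (p n).comp (Finsupp.lapply n : (ℕ →₀ L) →ₗ[ℝ] L)) (fun g => by
      obtain ⟨m, hm⟩ := hrng g
      refine ⟨m, fun n hn => ?_⟩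
      rw [Seminorm.comp_apply, Finsupp.lapply_apply, hm m le_rfl n hn, map_zero])
  have hW : ∀ (g : ℕ →₀ L) m, (∀ n ≥ m, g n = 0) → W g = ∑ n ∈ Finset.range m, p n (g n) := by
    intro g m hm
    exact hW1 g m fun n hn => by
      rw [Seminorm.comp_apply, Finsupp.lapply_apply, hm n hn, map_zero]
  have hW' : ∀ (g : ℕ →₀ L) m, ∑ n ∈ Finset.range m, p n (g n) ≤ W g := hW2
  have hWs : ∀ n h, W (Finsupp.single n h) = p n h := by
    intro n h
    rw [hW (Finsupp.single n h) (n + 1) (fun k hk => by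
      rw [Finsupp.single_apply, if_neg (by omega)]), Finset.sum_eq_single n]
    · simp
    · intro k _ hk
      rw [Finsupp.single_apply, if_neg hk.symm, map_zero]
    · intro h; exact absurd (Finset.mem_range.mpr (by omega)) h
  let 𝒮 : Submodule ℝ (ℕ →₀ L) :=
    { carrier := {s | ∀ n, s n ∈ S n}
      add_mem' := fun ha hb n => (S n).add_mem (ha n) (hb n)
      zero_mem' := fun n => (S n).zero_mem
      smul_mem' := fun r a ha n => (S n).smul_mem r (ha n) }
  have h𝒮s : ∀ n h, h ∈ S n → Finsupp.single n h ∈ 𝒮 := by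
    intro n h hh k
    rw [Finsupp.single_apply]
    split_ifs with hk
    · exact hk ▸ hh
    · exact (S k).zero_mem
  obtain ⟨pp, hpp1, hpp2⟩ := exists_inf_seminorm
    ((normSeminorm ℝ L).comp (tot.comp (LinearMap.snd ℝ (ℕ →₀ L) (ℕ →₀ L))) +
      W.comp (LinearMap.fst ℝ (ℕ →₀ L) (ℕ →₀ L) - LinearMap.snd ℝ (ℕ →₀ L) (ℕ →₀ L)))
    (Submodule.prod ⊥ 𝒮)
  let N₁ : Seminorm ℝ (ℕ →₀ L) := pp.comp (LinearMap.inl ℝ (ℕ →₀ L) (ℕ →₀ L))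
  have hNa : ∀ h, ∀ s ∈ 𝒮, N₁ h ≤ ‖tot s‖ + W (h - s) := by
    intro h s hs
    have := hpp1 (h, 0) (0, s) (Submodule.mem_prod.mpr ⟨Submodule.zero_mem _, hs⟩)
    simpa [N₁] using this
  have hNb : ∀ h ε, 0 < ε → ∃ s ∈ 𝒮, ‖tot s‖ + W (h - s) < N₁ h + ε := by
    intro h ε hε
    obtain ⟨⟨m0, s⟩, hm, hlt⟩ := hpp2 (h, 0) ε hε
    obtain ⟨h0, hs⟩ := Submodule.mem_prod.mp hm
    have h0' : m0 = 0 := by simpa using h0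
    subst h0'
    refine ⟨s, hs, ?_⟩
    simpa [N₁] using hlt
  have hNW : ∀ h, N₁ h ≤ W h := by
    intro h
    have := hNa h 0 𝒮.zero_mem
    simpa using this
  have htotW : ∀ g ∈ 𝒮, ‖tot g‖ ≤ W g := by
    intro g hg
    obtain ⟨m, hm⟩ := hrng g
    rw [htot g m (hm m le_rfl), hW g m (hm m le_rfl)]
    exact (norm_sum_le _ _).trans (Finset.sum_le_sum fun n _ => hpS n _ (hg n))
  have hNS : ∀ s ∈ 𝒮, N₁ s = ‖tot s‖ := by
    intro s hs
    refine le_antisymm ?_ (le_of_forall_pos_le_add fun ε hε => ?_)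
    · have := hNa s s hs
      simpa using this
    · obtain ⟨s', hs', hlt⟩ := hNb s ε hε
      have h1 := htotW _ (𝒮.sub_mem hs hs')
      have h2 := norm_add_le (tot s') (tot (s - s'))
      rw [← map_add, add_sub_cancel] at h2
      linarith
  let P : ℕ → (ℕ →₀ L) →ₗ[ℝ] (ℕ →₀ L) := fun m => Finsupp.lmapDomain L ℝ fun k => min k m
  have hPs : ∀ m k h, P m (Finsupp.single k h) = Finsupp.single (min k m) h := fun m k h => by
    simp [P]
  have hWP : ∀ m g, W (P m g) ≤ W g := by
    intro m g
    obtain ⟨M, hM⟩ := hrng g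
    conv_lhs => rw [hgsum g M (hM M le_rfl)]
    rw [map_sum, hW g M (hM M le_rfl)]
    refine (seminorm_sum_le W _ _).trans (Finset.sum_le_sum fun n _ => ?_)
    rw [hPs, hWs]
    exact hpm _ _ _ (min_le_left _ _)
  have hNP : ∀ m h, N₁ (P m h) ≤ 2 * N₁ h := by
    intro m h
    refine le_of_forall_pos_le_add fun ε hε => ?_
    obtain ⟨s, hs, hlt⟩ := hNb h (ε / 2) (by positivity)
    let s' := P m s - Finsupp.single m (tot s)
    have hs' : s' ∈ 𝒮 := by
      obtain ⟨M, hM⟩ := hrng s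
      have h1 : s' = ∑ n ∈ Finset.range M,
          (Finsupp.single (min n m) (s n) - Finsupp.single m (s n)) := by
        have h2 : P m s = ∑ n ∈ Finset.range M, Finsupp.single (min n m) (s n) := by
          conv_lhs => rw [hgsum s M (hM M le_rfl)]
          rw [map_sum]
          exact Finset.sum_congr rfl fun n _ => hPs _ _ _
        rw [Finset.sum_sub_distrib, ← h2, ← Finsupp.single_finsetSum, ← htot s M (hM M le_rfl)]
      rw [h1]
      refine 𝒮.sum_mem fun n _ => ?_
      rcases le_total m n with hmn | hmn
      · rw [min_eq_right hmn, sub_self]; exact 𝒮.zero_mem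
      · rw [min_eq_left hmn]
        exact 𝒮.sub_mem (h𝒮s _ _ (hs n)) (h𝒮s _ _ (hSmono n m hmn (hs n)))
    have htP : tot (P m s) = tot s := by
      obtain ⟨M, hM⟩ := hrng s
      conv_lhs => rw [hgsum s M (hM M le_rfl)]
      rw [map_sum, map_sum, htot s M (hM M le_rfl)]
      exact Finset.sum_congr rfl fun n _ => by rw [hPs, htots]
    have h0 : tot s' = 0 := by rw [map_sub, htP, htots, sub_self]
    have h1 := hNa (P m h) s' hs'
    have h2 : P m h - s' = P m (h - s) + Finsupp.single m (tot s) := by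
      rw [map_sub]; simp only [s']; abel
    have h3 := map_add_le_add W (P m (h - s)) (Finsupp.single m (tot s))
    have h4 := hWP m (h - s)
    have h5 := hp2 m (tot s)
    have h6 := apply_nonneg W (h - s)
    rw [hWs] at h3
    rw [h0, norm_zero, h2] at h1
    linarith
  have hdist := fun n => exists_inf_seminorm (p n) (S n)
  choose d hd1 hd2 using hdist
  let D : ℕ → L →ₗ[ℝ] (ℕ →₀ L) := fun n => Nat.casesOn n (Finsupp.lsingle 0)
    (fun k => Finsupp.lsingle (k + 1) - Finsupp.lsingle k)
  let Q : ℕ → (ℕ →₀ L) →ₗ[ℝ] (ℕ →₀ L) := fun n => Nat.casesOn n 0 P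
  have hD0 : ∀ h, D 0 h = Finsupp.single 0 h := fun h => rfl
  have hDs : ∀ k h, D (k + 1) h = Finsupp.single (k + 1) h - Finsupp.single k h := fun k h => rfl
  have hQ0 : ∀ v, Q 0 v = 0 := fun v => rfl
  have hQs : ∀ k v, Q (k + 1) v = P k v := fun k v => rfl
  have hxi : ∀ b, Finsupp.linearCombination ℝ (fun i => Finsupp.single (i + 1) (x i)) b ∈ 𝒮 := by
    intro b
    rw [Finsupp.linearCombination_apply, Finsupp.sum]
    exact 𝒮.sum_mem fun i _ => 𝒮.smul_mem _ (h𝒮s _ _ (hxS i))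
  have hxt : ∀ b, tot (Finsupp.linearCombination ℝ (fun i => Finsupp.single (i + 1) (x i)) b)
      = Finsupp.linearCombination ℝ x b := by
    intro b
    rw [Finsupp.linearCombination_apply, Finsupp.linearCombination_apply, Finsupp.sum,
      Finsupp.sum, map_sum]
    exact Finset.sum_congr rfl fun i _ => by rw [map_smul, htots]
  refine ⟨N₁, fun n => (d n).comp (Finsupp.lapply n), D, Q, l, ?_, ?_, ?_, ?_, ?_, ?_, ?_, ?_, ?_⟩
  · intro n v
    cases n with
    | zero =>
      rw [hQ0, map_zero]
      have := apply_nonneg N₁ v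
      positivity
    | succ n => exact hNP n v
  · intro n k h hk
    cases n with
    | zero => omega
    | succ n =>
      rw [hQs]
      cases k with
      | zero => rw [hD0, hPs, Nat.zero_min]
      | succ k => rw [hDs, map_sub, hPs, hPs, min_eq_left (by omega), min_eq_left (by omega)]
  · intro n k h hk
    cases n with
    | zero => exact hQ0 _
    | succ n =>
      cases k with
      | zero => omega
      | succ k =>
        rw [hQs, hDs, map_sub, hPs, hPs, min_eq_right (by omega), min_eq_right (by omega), sub_self]
  · intro n h hh
    have h1 := hpl n h hh
    refine le_antisymm ?_ (apply_nonneg _ _)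
    refine (hNW _).trans ?_
    cases n with
    | zero => rw [hD0, hWs, h1]
    | succ k =>
      rw [hDs]
      refine (map_sub_le_add W _ _).trans ?_
      rw [hWs, hWs, h1]
      have := hpm k (k + 1) h (by omega)
      linarith
  · intro n h
    induction n with
    | zero => simp [hD0]
    | succ n ih => rw [Finset.sum_range_succ, ih, hDs]; abel
  · intro b
    rw [hNS _ (hxi b), hxt]
  · intro v m
    refine le_of_forall_pos_le_add fun ε hε => ?_
    obtain ⟨s, hs, hlt⟩ := hNb v ε hε
    have h1 := hW' (v - s) m
    have h2 : ∑ n ∈ Finset.range m, d n (v n) ≤ ∑ n ∈ Finset.range m, p n ((v - s) n) := by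
      refine Finset.sum_le_sum fun n _ => ?_
      have := hd1 n (v n) (-(s n)) ((S n).neg_mem (hs n))
      rwa [← sub_eq_add_neg] at this
    have h3 := norm_nonneg (tot s)
    change ∑ n ∈ Finset.range m, d n (v n) ≤ _
    linarith
  · intro n k h hk
    change d n (D k h n) = 0
    cases k with
    | zero => omega
    | succ k =>
      rw [hDs, Finsupp.sub_apply, Finsupp.single_apply, Finsupp.single_apply,
        if_neg (by omega), if_neg (by omega), sub_self, map_zero]
  · intro v ε hε
    obtain ⟨m, hm⟩ := hrng v
    choose t ht1 ht2 using fun n => hd2 n (v n) (ε / (m + 1)) (by positivity)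
    let s : ℕ →₀ L := ∑ n ∈ Finset.range m, Finsupp.single n (-(t n))
    have hs : s ∈ 𝒮 := 𝒮.sum_mem fun n _ => h𝒮s _ _ ((S n).neg_mem (ht1 n))
    have htspan : tot s ∈ Submodule.span ℝ (Set.range x) := by
      simp only [s, map_sum]
      refine Submodule.sum_mem _ fun n _ => ?_
      rw [htots]
      exact Submodule.neg_mem _ (Submodule.span_mono (Set.image_subset_range _ _) (ht1 n))
    obtain ⟨b, hb⟩ := (Finsupp.mem_span_range_iff_exists_finsupp).mp htspan
    have hb' : Finsupp.linearCombination ℝ x b = tot s := by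
      rw [Finsupp.linearCombination_apply]; exact hb
    refine ⟨b, m, fun m' hm' => ?_⟩
    set w := Finsupp.linearCombination ℝ (fun i => Finsupp.single (i + 1) (x i)) b with hw
    have h1 : N₁ (s - w) = 0 := by
      rw [hNS _ (𝒮.sub_mem hs (hxi b)), map_sub, hxt, hb', sub_self, norm_zero]
    have h2 : v - w = (v - s) + (s - w) := by abel
    have h3 := map_add_le_add N₁ (v - s) (s - w)
    rw [← h2, h1, add_zero] at h3
    refine h3.trans ((hNW _).trans ?_)
    have h4 : v - s = ∑ n ∈ Finset.range m, Finsupp.single n (v n + t n) := by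
      conv_lhs => rw [hgsum v m (hm m le_rfl)]
      simp only [s]
      rw [← Finset.sum_sub_distrib]
      refine Finset.sum_congr rfl fun n _ => ?_
      rw [Finsupp.single_neg, sub_neg_eq_add, Finsupp.single_add]
    rw [h4]
    refine (seminorm_sum_le W _ _).trans ?_
    calc _ ≤ ∑ n ∈ Finset.range m, (d n (v n) + ε / (m + 1)) := by
          refine Finset.sum_le_sum fun n _ => ?_
          rw [hWs]
          exact (ht2 n).le
      _ = ∑ n ∈ Finset.range m, d n (v n) + m * (ε / (m + 1)) := by
          rw [Finset.sum_add_distrib]; simp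
      _ ≤ ∑ n ∈ Finset.range m', d n (v n) + ε := by
          have e1 : ∑ n ∈ Finset.range m, d n (v n) ≤ ∑ n ∈ Finset.range m', d n (v n) :=
            Finset.sum_le_sum_of_subset_of_nonneg (Finset.range_mono hm')
              (fun n _ _ => apply_nonneg (d n) _)
          have e2 : (m : ℝ) * (ε / (m + 1)) ≤ ε := by
            rw [mul_div_assoc', div_le_iff₀ (by positivity)]
            nlinarith
          linarith
      _ = _ := rfl

theorem thmE {L : Type*} [NormedAddCommGroup L] [NormedSpace ℝ L] (x : ℕ → L) :
    ∃ (N : Seminorm ℝ (ℕ →₀ ℝ)) (ρ : ℕ → Seminorm ℝ (ℕ →₀ ℝ)) (ξ : ℕ → (ℕ →₀ ℝ)),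
      (∀ b, N (Finsupp.linearCombination ℝ ξ b) = ‖Finsupp.linearCombination ℝ x b‖) ∧
      (∀ a m, N (a.filter (· < m)) ≤ 62 * N a) ∧
      (∀ j, 0 < N (Finsupp.single j 1)) ∧
      (∀ a m, ∑ n ∈ Finset.range m, ρ n a ≤ N a) ∧
      (∀ n, ∃ M, ∀ j ≥ M, ρ n (Finsupp.single j 1) = 0) ∧
      (∀ a ε, 0 < ε → ∃ b m, N (a - Finsupp.linearCombination ℝ ξ b)
        ≤ ∑ n ∈ Finset.range m, ρ n a + ε) := by
  classical
  obtain ⟨N₁, σ, D, Q, l, h1, h2, h3, h4, h5, h6, h7, h8, h9⟩ := stage_one x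
  obtain ⟨Φ, τ, Θ, k1, k2, k3, k4, k5, k6, k7⟩ := pel N₁ D Q h1 h2 h3 l h4
  choose ζ hζ1 hζ2 using k7
  let ξ : ℕ → (ℕ →₀ ℝ) := fun i => ∑ k ∈ Finset.range (i + 2), ζ k (x i)
  have hξ1 : ∀ i, N₁ (Φ (ξ i) - Finsupp.single (i + 1) (x i)) = 0 := by
    intro i
    rw [← h5 (i + 1) (x i)]
    simp only [ξ]
    rw [map_sum, ← Finset.sum_sub_distrib]
    refine le_antisymm ((seminorm_sum_le N₁ _ _).trans (Finset.sum_nonpos fun k _ => ?_))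
      (apply_nonneg _ _)
    rw [hζ1]
  have hξ2 : ∀ i, Θ (ξ i) = 0 := by
    intro i
    refine le_antisymm ((seminorm_sum_le Θ _ _).trans (Finset.sum_nonpos fun k _ => ?_))
      (apply_nonneg _ _)
    rw [hζ2]
  let w : (ℕ →₀ ℝ) → (ℕ →₀ L) := fun b =>
    Finsupp.linearCombination ℝ (fun i => Finsupp.single (i + 1) (x i)) b
  have hw : ∀ b, N₁ (Φ (Finsupp.linearCombination ℝ ξ b) - w b) = 0 := by
    intro b
    have := seminorm_lc_zero N₁ _ hξ1 b
    convert this using 2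
    simp only [w, Finsupp.linearCombination_apply, Finsupp.sum, map_sum, map_smul, smul_sub,
      Finset.sum_sub_distrib]
  have hΘ : ∀ b, Θ (Finsupp.linearCombination ℝ ξ b) = 0 := seminorm_lc_zero Θ _ hξ2
  refine ⟨N₁.comp Φ + Θ, fun n => (σ n).comp Φ + τ n, ξ, ?_, k3, k4, ?_, ?_, ?_⟩
  · intro b
    change N₁ (Φ _) + Θ _ = _
    rw [hΘ, add_zero, seminorm_eq_of_sub N₁ (hw b)]
    exact h6 b
  · intro a m
    change ∑ n ∈ Finset.range m, (σ n (Φ a) + τ n a) ≤ N₁ (Φ a) + Θ a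
    rw [Finset.sum_add_distrib]
    exact add_le_add (h7 _ _) (k2 _ _)
  · intro n
    obtain ⟨M, hM⟩ := k5 n
    obtain ⟨M', hM'⟩ := k6 (n + 2)
    refine ⟨M + M', fun j hj => ?_⟩
    obtain ⟨k, hk, h, hh⟩ := hM' j (by omega)
    change σ n (Φ _) + τ n _ = 0
    rw [hM j (by omega), hh, h8 n k h hk, add_zero]
  · intro a ε hε
    obtain ⟨b, m, hb⟩ := h9 (Φ a) ε hε
    obtain ⟨m', hm'⟩ := k1 a
    refine ⟨b, m + m', ?_⟩
    change N₁ (Φ _) + Θ _ ≤ ∑ n ∈ Finset.range (m + m'), (σ n (Φ a) + τ n a) + ε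
    rw [Finset.sum_add_distrib, ← hm' (m + m') (by omega)]
    have e1 := hb (m + m') (by omega)
    have e2 := map_sub_le_add Θ a (Finsupp.linearCombination ℝ ξ b)
    rw [hΘ, add_zero] at e2
    have e3 : N₁ (Φ (a - Finsupp.linearCombination ℝ ξ b)) = N₁ (Φ a - w b) := by
      refine seminorm_eq_of_sub N₁ ?_
      have h : Φ (a - Finsupp.linearCombination ℝ ξ b) - (Φ a - w b)
          = -(Φ (Finsupp.linearCombination ℝ ξ b) - w b) := by
        rw [map_sub Φ]; abel
      rw [h, map_neg_eq_map]
      exact hw b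
    rw [e3]
    change N₁ (Φ a - w b) ≤ _ at e1
    linarith

/-- Rational coefficients as real coefficients. -/
noncomputable def castQ (a : ℕ →₀ ℚ) : ℕ →₀ ℝ :=
  a.mapRange (fun q : ℚ => (q : ℝ)) Rat.cast_zero

theorem castQ_add (a b : ℕ →₀ ℚ) : castQ (a + b) = castQ a + castQ b := by
  ext i; simp [castQ]

theorem rat_approx {B : Type*} [NormedAddCommGroup B] [NormedSpace ℝ B]
    (G : (ℕ →₀ ℝ) →ₗ[ℝ] B) (a : ℕ →₀ ℝ) : ∀ ε : ℝ, 0 < ε → ∃ a' : ℕ →₀ ℚ,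
      ‖G a - G (castQ a')‖ < ε := by
  induction a using Finsupp.induction_linear with
  | zero =>
    intro ε hε
    refine ⟨0, ?_⟩
    have : castQ 0 = 0 := by ext i; simp [castQ]
    rw [this]; simpa using hε
  | add a b ha hb =>
    intro ε hε
    obtain ⟨a', ha'⟩ := ha (ε / 2) (by positivity)
    obtain ⟨b', hb'⟩ := hb (ε / 2) (by positivity)
    refine ⟨a' + b', ?_⟩
    rw [castQ_add, map_add, map_add, add_sub_add_comm]
    refine (norm_add_le _ _).trans_lt ?_
    linarith
  | single j r =>
    intro ε hε
    set K := ‖G (Finsupp.single j 1)‖ with hK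
    have hK0 : 0 ≤ K := norm_nonneg _
    obtain ⟨s, hs⟩ := exists_rat_near r (ε := ε / (K + 1)) (by positivity)
    refine ⟨Finsupp.single j s, ?_⟩
    have h1 : castQ (Finsupp.single j s) = Finsupp.single j (s : ℝ) := by
      simp [castQ]
    have h2 : G (Finsupp.single j r) - G (Finsupp.single j (s : ℝ))
        = (r - s) • G (Finsupp.single j 1) := by
      rw [← map_sub, ← map_smul, ← Finsupp.single_sub, Finsupp.smul_single_one]
    rw [h1, h2, norm_smul, Real.norm_eq_abs, ← hK]
    calc _ ≤ ε / (K + 1) * K := by gcongr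
      _ < ε / (K + 1) * (K + 1) := by gcongr; linarith
      _ = ε := by field_simp

theorem lin_tail {B : Type*} [AddCommGroup B] [Module ℝ B] (z : ℕ → B) (M : ℕ)
    (hz : ∀ j ≥ M, z j = 0) (a : ℕ →₀ ℝ) :
    Finsupp.linearCombination ℝ z a = ∑ j ∈ Finset.range M, a j • z j := by
  obtain ⟨M', h⟩ := lin_eq_range z a
  rw [h (M + M') (by omega)]
  symm
  refine Finset.sum_subset (Finset.range_mono (by omega)) fun j _ hj => ?_
  rw [hz j (by simpa using hj), smul_zero]

theorem good_props {Z B : Type*} [NormedAddCommGroup Z] [NormedSpace ℝ Z] [CompleteSpace Z]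
    [NormedAddCommGroup B] [NormedSpace ℝ B] [CompleteSpace B]
    (hmin : IsMinimal Z) (hl1 : ¬ Embeds EllOne Z)
    (x g x' : ℕ → B) (v : ℕ → ℕ → B)
    (h1 : ∀ b, ‖Finsupp.linearCombination ℝ x b‖ = ‖Finsupp.linearCombination ℝ x' b‖)
    (h2 : ∀ i, ∀ k : ℕ, ∃ a, ‖x' i - Finsupp.linearCombination ℝ g a‖ < 1 / ((k : ℝ) + 1))
    (h3 : ∀ j, g j ≠ 0)
    (h4 : ∀ (a : ℕ →₀ ℝ) (m : ℕ), ‖Finsupp.linearCombination ℝ g (a.filter (· < m))‖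
      ≤ 62 * ‖Finsupp.linearCombination ℝ g a‖)
    (h5 : ∀ (a : ℕ →₀ ℝ) (m : ℕ), ∑ n ∈ Finset.range m, ‖Finsupp.linearCombination ℝ (v n) a‖
      ≤ ‖Finsupp.linearCombination ℝ g a‖)
    (h6 : ∀ n, ∃ M, ∀ j ≥ M, v n j = 0)
    (h7 : ∀ (a : ℕ →₀ ℚ) (k : ℕ), ∃ (b : ℕ →₀ ℝ) (m : ℕ),
      ‖Finsupp.linearCombination ℝ g (castQ a) - Finsupp.linearCombination ℝ x' b‖
        < ∑ n ∈ Finset.range m, ‖Finsupp.linearCombination ℝ (v n) (castQ a)‖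
          + 1 / ((k : ℝ) + 1))
    (hX : ¬ Embeds Z (clRange (Finsupp.linearCombination ℝ x))) :
    ¬ Embeds Z (clRange (Finsupp.linearCombination ℝ g)) ∧
    HasSchauderBasis (clRange (Finsupp.linearCombination ℝ g)) ∧
    EmbedsIsometrically (clRange (Finsupp.linearCombination ℝ x))
      (clRange (Finsupp.linearCombination ℝ g)) := by
  classical
  set G := Finsupp.linearCombination ℝ g with hG
  have hG0 : ∀ j, G (Finsupp.single j 1) ≠ 0 := fun j => by simpa [hG] using h3 j
  have hcomp : ∀ H : (ℕ →₀ ℝ) →ₗ[ℝ] B, CompleteSpace (clRange H) := fun H =>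
    (Submodule.isClosed_topologicalClosure _).completeSpace_coe
  have := hcomp G
  have := hcomp (Finsupp.linearCombination ℝ x)
  have hmem : ∀ i, x' i ∈ clRange G := by
    intro i
    change x' i ∈ closure (LinearMap.range G : Set B)
    rw [Metric.mem_closure_iff]
    intro ε hε
    obtain ⟨k, hk⟩ := exists_nat_one_div_lt hε
    obtain ⟨a, ha⟩ := h2 i k
    exact ⟨_, ⟨a, rfl⟩, by rw [dist_eq_norm]; exact ha.trans hk⟩
  let u : ℕ → clRange G := fun i => ⟨x' i, hmem i⟩
  have hu : ∀ b, ((Finsupp.linearCombination ℝ u b : clRange G) : B)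
      = Finsupp.linearCombination ℝ x' b := by
    intro b
    exact Finsupp.apply_linearCombination ℝ (clRange G).subtype u b
  have hun : ∀ b, ‖Finsupp.linearCombination ℝ u b‖ = ‖Finsupp.linearCombination ℝ x b‖ := by
    intro b
    rw [h1, ← hu]; rfl
  refine ⟨?_, schauder_of_bound G 62 (by norm_num) hG0 h4, ?_⟩
  · have hq : ∀ n, ∃ q : clRange G →L[ℝ] B,
        (∀ a, q (toCl G a) = Finsupp.linearCombination ℝ (v n) a) := by
      intro n
      obtain ⟨q, hq, -⟩ := ext_lemma G (Finsupp.linearCombination ℝ (v n)) 1 (by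
        intro a
        rw [one_mul]
        refine le_trans ?_ (h5 a (n + 1))
        exact Finset.single_le_sum
          (f := fun n => ‖Finsupp.linearCombination ℝ (v n) a‖)
          (fun _ _ => norm_nonneg _) (by simp))
      exact ⟨q, hq⟩
    choose q hq using hq
    obtain ⟨c, hc⟩ := exists_coord G 62 hG0 h4
    have hsum : ∀ y m, ∑ n ∈ Finset.range m, ‖q n y‖ ≤ 1 * ‖y‖ := by
      intro y m
      refine (toCl_dense G).induction_on (p := fun y =>
        ∑ n ∈ Finset.range m, ‖q n y‖ ≤ 1 * ‖y‖) y
        (isClosed_le (by fun_prop) (by fun_prop)) fun a => ?_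
      simp only [hq, one_mul]
      exact h5 a m
    refine not_embeds_of_quot hmin hl1 (clRange (Finsupp.linearCombination ℝ u))
      (Submodule.isClosed_topologicalClosure _) q 1 one_pos ?_ hsum ?_ ?_
    · intro n
      obtain ⟨M, hM⟩ := h6 n
      refine ⟨(Finset.range M).image c, fun y hy => ?_⟩
      have key : ∀ y, q n y = ∑ j ∈ Finset.range M, c j y • v n j := by
        intro y
        refine (toCl_dense G).induction_on (p := fun y =>
          q n y = ∑ j ∈ Finset.range M, c j y • v n j) y
          (isClosed_eq (by fun_prop) (by fun_prop)) fun a => ?_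
        simp only [hq, hc]
        exact lin_tail _ _ hM a
      rw [key]
      refine Finset.sum_eq_zero fun j hj => ?_
      rw [hy _ (Finset.mem_image_of_mem _ hj), zero_smul]
    · intro y ε hε
      obtain ⟨a, ha⟩ := exists_approx G y (ε := ε / 8) (by positivity)
      obtain ⟨a', ha'⟩ := rat_approx (toCl G) a (ε / 8) (by positivity)
      obtain ⟨k, hk⟩ := exists_nat_one_div_lt (show 0 < ε / 4 by positivity)
      obtain ⟨b, m, hb⟩ := h7 a' k
      refine ⟨Finsupp.linearCombination ℝ u b, mem_clRange _ b, ?_⟩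
      set y' := toCl G (castQ a') with hy'
      have e1 : ‖y - y'‖ ≤ ε / 4 := by
        have : y - y' = (y - toCl G a) + (toCl G a - y') := by abel
        rw [this]
        refine (norm_add_le _ _).trans ?_
        linarith
      have e2 : ‖y' - Finsupp.linearCombination ℝ u b‖
          < ∑ n ∈ Finset.range m, ‖q n y'‖ + ε / 4 := by
        have : ‖y' - Finsupp.linearCombination ℝ u b‖
            = ‖G (castQ a') - Finsupp.linearCombination ℝ x' b‖ := by
          rw [← hu]; rfl
        rw [this]
        simp only [hy', hq]
        linarith
      have e3 : ∑ n ∈ Finset.range m, ‖q n y'‖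
          ≤ ∑ n ∈ Finset.range m, ‖q n y‖ + ∑ n ∈ Finset.range m, ‖q n (y' - y)‖ := by
        rw [← Finset.sum_add_distrib]
        refine Finset.sum_le_sum fun n _ => ?_
        have : q n y' = q n y + q n (y' - y) := by rw [← map_add]; congr 1; abel
        rw [this]
        exact norm_add_le _ _
      have e4 := hsum (y' - y) m
      rw [norm_sub_rev, one_mul] at e4
      have e5 : ∑ n ∈ Finset.range m, ‖q n y‖ ≤ ∑' n, ‖q n y‖ :=
        (summable_of_sum_range_le (fun _ => norm_nonneg _) (hsum y)).sum_le_tsum _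
          (fun _ _ => norm_nonneg _)
      have e6 : y - Finsupp.linearCombination ℝ u b
          = (y - y') + (y' - Finsupp.linearCombination ℝ u b) := by abel
      rw [e6]
      refine (norm_add_le _ _).trans ?_
      linarith
    · intro hemb
      apply hX
      obtain ⟨J, hJ, -⟩ := ext_lemma (Finsupp.linearCombination ℝ u)
        (toCl (Finsupp.linearCombination ℝ x)) 1 (fun b => by
          rw [one_mul, hun]; exact le_rfl)
      refine hemb.trans' ⟨J, 1, one_pos, fun y => ?_⟩
      refine (toCl_dense _).induction_on (p := fun y => 1 * ‖y‖ ≤ ‖J y‖) y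
        (isClosed_le (by fun_prop) (by fun_prop)) fun b => ?_
      rw [hJ, one_mul]
      exact (hun b).le
  · obtain ⟨J, hJ, -⟩ := ext_lemma (Finsupp.linearCombination ℝ x)
      (Finsupp.linearCombination ℝ u) 1 (fun b => by rw [one_mul, hun])
    refine ⟨⟨J.toLinearMap, fun y => ?_⟩⟩
    change ‖J y‖ = ‖y‖
    refine (toCl_dense _).induction_on (p := fun y => ‖J y‖ = ‖y‖) y
      (isClosed_eq (by fun_prop) (by fun_prop)) fun b => ?_
    rw [hJ]
    exact hun b

theorem polish_params (E : Type*) [TopologicalSpace E] [PolishSpace E] :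
    PolishSpace ((ℕ → ℕ) × (ℕ → E) × (ℕ → E) × (ℕ → E) × (ℕ → ℕ → E)) := inferInstance

/-- The closed span of a sequence, as an element of `SB`. -/
noncomputable def clSpan (g : ℕ → CantorC) : SB :=
  ⟨clRange (Finsupp.linearCombination ℝ g), Submodule.isClosed_topologicalClosure _⟩

theorem continuous_lin {P E : Type*} [TopologicalSpace P] [NormedAddCommGroup E] [NormedSpace ℝ E]
    (g : P → ℕ → E) (hg : Continuous g) (a : ℕ →₀ ℝ) :
    Continuous fun p => Finsupp.linearCombination ℝ (g p) a := by
  simp only [Finsupp.linearCombination_apply, Finsupp.sum]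
  fun_prop

theorem clSpan_inter (g : ℕ → CantorC) (U : Set CantorC) (hU : IsOpen U) :
    (((clSpan g).1 : Set CantorC) ∩ U).Nonempty ↔
      ∃ a, Finsupp.linearCombination ℝ g a ∈ U := by
  change (closure (LinearMap.range (Finsupp.linearCombination ℝ g) : Set CantorC) ∩ U).Nonempty ↔ _
  rw [closure_inter_open_nonempty_iff hU]
  constructor
  · rintro ⟨_, ⟨a, rfl⟩, h⟩
    exact ⟨a, h⟩
  · rintro ⟨a, h⟩
    exact ⟨_, ⟨a, rfl⟩, h⟩

theorem measurable_clSpan {P : Type*} [TopologicalSpace P] [MeasurableSpace P] [BorelSpace P]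
    (g : P → ℕ → CantorC) (hg : Continuous g) : Measurable fun p => clSpan (g p) := by
  refine measurable_generateFrom ?_
  rintro _ ⟨U, hU, rfl⟩
  have : (fun p => clSpan (g p)) ⁻¹' {Y : SB | ((Y.1 : Set CantorC) ∩ U).Nonempty}
      = ⋃ a : ℕ →₀ ℝ, {p | Finsupp.linearCombination ℝ (g p) a ∈ U} := by
    ext p
    simp only [Set.mem_preimage, Set.mem_setOf_eq, clSpan_inter _ U hU, Set.mem_iUnion]
  rw [this]
  exact (isOpen_iUnion fun a => hU.preimage (continuous_lin g hg a)).measurableSet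

theorem measurable_hit (U : Set CantorC) (hU : IsOpen U) :
    MeasurableSet {Y : SB | ((Y.1 : Set CantorC) ∩ U).Nonempty} :=
  MeasurableSpace.measurableSet_generateFrom ⟨U, hU, rfl⟩

theorem SB_eq_iff (X Y : SB) : X = Y ↔ ∀ U ∈ TopologicalSpace.countableBasis CantorC,
    (((X.1 : Set CantorC) ∩ U).Nonempty ↔ ((Y.1 : Set CantorC) ∩ U).Nonempty) := by
  constructor
  · rintro rfl U _
    exact Iff.rfl
  · intro h
    have key : ∀ X Y : SB, (∀ U ∈ TopologicalSpace.countableBasis CantorC,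
        (((X.1 : Set CantorC) ∩ U).Nonempty → ((Y.1 : Set CantorC) ∩ U).Nonempty)) →
        X.1 ≤ Y.1 := by
      intro X Y h z hz
      have : z ∈ closure (Y.1 : Set CantorC) := by
        rw [(TopologicalSpace.isBasis_countableBasis CantorC).mem_closure_iff]
        intro U hU hzU
        have := h U hU ⟨z, hz, hzU⟩
        rwa [Set.inter_comm] at this
      rwa [Y.2.closure_eq] at this
    exact Subtype.ext (le_antisymm (key X Y fun U hU => (h U hU).1)
      (key Y X fun U hU => (h U hU).2))

theorem measurable_SB_eq {P : Type*} [MeasurableSpace P] (f h : P → SB) (hf : Measurable f)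
    (hh : Measurable h) : MeasurableSet {p | f p = h p} := by
  have : {p | f p = h p} = ⋂ U ∈ TopologicalSpace.countableBasis CantorC,
      {p | (((f p).1 : Set CantorC) ∩ U).Nonempty ↔ (((h p).1 : Set CantorC) ∩ U).Nonempty} := by
    ext p
    simp only [Set.mem_setOf_eq, Set.mem_iInter, SB_eq_iff]
  rw [this]
  refine MeasurableSet.biInter (TopologicalSpace.countable_countableBasis _) fun U hU => ?_
  have hUo := TopologicalSpace.isOpen_of_mem_countableBasis hU
  exact MeasurableSet.iff (hf (measurable_hit U hUo)) (hh (measurable_hit U hUo))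

/-- The conditions on the parameters. -/
def GoodParam (x g x' : ℕ → CantorC) (v : ℕ → ℕ → CantorC) : Prop :=
    (∀ b, ‖Finsupp.linearCombination ℝ x b‖ = ‖Finsupp.linearCombination ℝ x' b‖) ∧
    (∀ i, ∀ k : ℕ, ∃ a, ‖x' i - Finsupp.linearCombination ℝ g a‖ < 1 / ((k : ℝ) + 1)) ∧
    (∀ j, g j ≠ 0) ∧
    (∀ (a : ℕ →₀ ℝ) (m : ℕ), ‖Finsupp.linearCombination ℝ g (a.filter (· < m))‖
      ≤ 62 * ‖Finsupp.linearCombination ℝ g a‖) ∧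
    (∀ (a : ℕ →₀ ℝ) (m : ℕ), ∑ n ∈ Finset.range m, ‖Finsupp.linearCombination ℝ (v n) a‖
      ≤ ‖Finsupp.linearCombination ℝ g a‖) ∧
    (∀ n, ∃ M, ∀ j ≥ M, v n j = 0) ∧
    (∀ (a : ℕ →₀ ℚ) (k : ℕ), ∃ (b : ℕ →₀ ℝ) (m : ℕ),
      ‖Finsupp.linearCombination ℝ g (castQ a) - Finsupp.linearCombination ℝ x' b‖
        < ∑ n ∈ Finset.range m, ‖Finsupp.linearCombination ℝ (v n) (castQ a)‖
          + 1 / ((k : ℝ) + 1))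

theorem measurable_good {P : Type*} [TopologicalSpace P] [MeasurableSpace P] [BorelSpace P]
    (x g x' : P → ℕ → CantorC) (v : P → ℕ → ℕ → CantorC)
    (hx : Continuous x) (hg : Continuous g) (hx' : Continuous x') (hv : Continuous v) :
    MeasurableSet {p | GoodParam (x p) (g p) (x' p) (v p)} := by
  have cx := continuous_lin x hx
  have cg := continuous_lin g hg
  have cx' := continuous_lin x' hx'
  have cv : ∀ n a, Continuous fun p => Finsupp.linearCombination ℝ (v p n) a := fun n a =>
    continuous_lin (fun p => v p n) (by fun_prop) a
  have cgi : ∀ i, Continuous fun p => g p i := fun i => by fun_prop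
  have cxi : ∀ i, Continuous fun p => x' p i := fun i => by fun_prop
  have cvi : ∀ n i, Continuous fun p => v p n i := fun n i => by fun_prop
  unfold GoodParam
  refine MeasurableSet.inter ?_ (MeasurableSet.inter ?_ (MeasurableSet.inter ?_
    (MeasurableSet.inter ?_ (MeasurableSet.inter ?_ (MeasurableSet.inter ?_ ?_)))))
  · change MeasurableSet {p | ∀ b, _}
    rw [Set.setOf_forall]
    exact (isClosed_iInter fun b => isClosed_eq (cx b).norm (cx' b).norm).measurableSet
  · change MeasurableSet {p | ∀ i, ∀ k : ℕ, ∃ a, _}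
    simp only [Set.setOf_forall, Set.setOf_exists]
    refine MeasurableSet.iInter fun i => MeasurableSet.iInter fun k => ?_
    exact (isOpen_iUnion fun a => isOpen_lt ((cxi i).sub (cg a)).norm
      continuous_const).measurableSet
  · change MeasurableSet {p | ∀ i, _}
    simp only [Set.setOf_forall]
    refine MeasurableSet.iInter fun i => ?_
    exact (isOpen_ne_fun (cgi i) continuous_const).measurableSet
  · change MeasurableSet {p | ∀ a m, _}
    simp only [Set.setOf_forall]
    exact (isClosed_iInter fun a => isClosed_iInter fun m =>
      isClosed_le (cg _).norm (continuous_const.mul (cg a).norm)).measurableSet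
  · change MeasurableSet {p | ∀ a m, _}
    simp only [Set.setOf_forall]
    exact (isClosed_iInter fun a => isClosed_iInter fun m =>
      isClosed_le (continuous_finset_sum _ fun n _ => (cv n a).norm) (cg a).norm).measurableSet
  · change MeasurableSet {p | ∀ n, ∃ M, ∀ j, j ≥ M → _}
    simp only [Set.setOf_forall, Set.setOf_exists]
    refine MeasurableSet.iInter fun n => MeasurableSet.iUnion fun M =>
      MeasurableSet.iInter fun j => MeasurableSet.iInter fun _ => ?_
    exact (isClosed_eq (cvi n j) continuous_const).measurableSet
  · change MeasurableSet {p | ∀ a k, ∃ b m, _}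
    simp only [Set.setOf_forall, Set.setOf_exists]
    refine MeasurableSet.iInter fun a => MeasurableSet.iInter fun k => ?_
    exact (isOpen_iUnion fun b => isOpen_iUnion fun m => isOpen_lt
      ((cg _).sub (cx' b)).norm ((continuous_finset_sum _ fun n _ => (cv n _).norm).add
        continuous_const)).measurableSet

theorem lin_of_map {B : Type*} [AddCommGroup B] [Module ℝ B] (G : (ℕ →₀ ℝ) →ₗ[ℝ] B) :
    Finsupp.linearCombination ℝ (fun j => G (Finsupp.single j 1)) = G := by
  ext j; simp

theorem exists_good (X : SB) : ∃ x g x' v, clSpan x = X ∧ GoodParam x g x' v := by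
  let d : ℕ → X.1 := TopologicalSpace.denseSeq X.1
  let x : ℕ → CantorC := fun i => d i
  have hxX : clSpan x = X := by
    refine Subtype.ext (le_antisymm ?_ ?_)
    · refine Submodule.topologicalClosure_minimal _ ?_ X.2
      rw [Finsupp.range_linearCombination, Submodule.span_le]
      rintro _ ⟨i, rfl⟩
      exact (d i).2
    · intro y hy
      change y ∈ closure (LinearMap.range (Finsupp.linearCombination ℝ x) : Set CantorC)
      rw [Metric.mem_closure_iff]
      intro ε hε
      obtain ⟨i, hi⟩ := (TopologicalSpace.denseRange_denseSeq X.1).exists_dist_lt ⟨y, hy⟩ hε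
      exact ⟨x i, ⟨Finsupp.single i 1, by simp⟩, hi⟩
  obtain ⟨N, ρ, ξ, k1, k2, k3, k4, k5, k6⟩ := thmE x
  obtain ⟨G, hG⟩ := bm_embedding N
  have hH : ∀ n, ∃ H : (ℕ →₀ ℝ) →ₗ[ℝ] CantorC, ∀ a, ‖H a‖ = ρ n a := fun n => bm_embedding (ρ n)
  choose H hH using hH
  have hξ : ∀ b, Finsupp.linearCombination ℝ (fun i => G (ξ i)) b
      = G (Finsupp.linearCombination ℝ ξ b) := fun b =>
    (Finsupp.apply_linearCombination ℝ G ξ b).symm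
  refine ⟨x, fun j => G (Finsupp.single j 1), fun i => G (ξ i),
    fun n j => H n (Finsupp.single j 1), hxX, ?_⟩
  unfold GoodParam
  simp only [lin_of_map, hξ, hG, hH, ← map_sub G]
  refine ⟨fun b => (k1 b).symm, fun i k => ⟨ξ i, ?_⟩, fun j h => ?_, k2, k4, fun n => ?_,
    fun a k => ?_⟩
  · rw [sub_self, map_zero]; positivity
  · have := k3 j
    rw [← hG, h, norm_zero] at this
    exact lt_irrefl _ this
  · obtain ⟨M, hM⟩ := k5 n
    refine ⟨M, fun j hj => ?_⟩
    rw [← norm_eq_zero, hH, hM j hj]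
  · obtain ⟨b, m, h⟩ := k6 (castQ a) (1 / ((k : ℝ) + 1) / 2) (by positivity)
    refine ⟨b, m, ?_⟩
    have : 0 < 1 / ((k : ℝ) + 1) := by positivity
    linarith

/-- **Corollary.** Let `Z` be a minimal Banach space not containing `ℓ₁`. For every
analytic subset `A` of `NC_Z` there is an analytic subset `A'` of `NC_Z` such that
every `Y ∈ A'` has a Schauder basis and every `X ∈ A` admits a `Y ∈ A'` containing an
isometric copy of `X`. -/
theorem analytic_NCZ_subset_with_bases (Z : Type*) [NormedAddCommGroup Z]
    [NormedSpace ℝ Z] [CompleteSpace Z]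
    (hmin : IsMinimal Z) (hZl1 : ¬ Embeds EllOne Z)
    (A : Set SB) (hA : IsAnalyticIn A) (hAsub : A ⊆ NCin Z) :
    ∃ A' : Set SB, IsAnalyticIn A' ∧ A' ⊆ NCin Z ∧
      (∀ Y ∈ A', HasSchauderBasis ↥Y.1) ∧
      (∀ X ∈ A, ∃ Y ∈ A', EmbedsIsometrically ↥X.1 ↥Y.1) := by
  obtain ⟨f, hf, rfl⟩ := hA
  let P : Type := (ℕ → ℕ) × (ℕ → CantorC) × (ℕ → CantorC) × (ℕ → CantorC) × (ℕ → ℕ → CantorC)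
  letI : TopologicalSpace P := inferInstanceAs (TopologicalSpace
    ((ℕ → ℕ) × (ℕ → CantorC) × (ℕ → CantorC) × (ℕ → CantorC) × (ℕ → ℕ → CantorC)))
  haveI : PolishSpace P := polish_params CantorC
  letI : MeasurableSpace P := borel P
  haveI : BorelSpace P := ⟨rfl⟩
  let pσ : P → (ℕ → ℕ) := fun p => p.1
  let px : P → (ℕ → CantorC) := fun p => p.2.1
  let pg : P → (ℕ → CantorC) := fun p => p.2.2.1
  let px' : P → (ℕ → CantorC) := fun p => p.2.2.2.1
  let pv : P → (ℕ → ℕ → CantorC) := fun p => p.2.2.2.2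
  have cσ : Continuous pσ := continuous_fst
  have cx : Continuous px := continuous_fst.comp continuous_snd
  have cg : Continuous pg := continuous_fst.comp (continuous_snd.comp continuous_snd)
  have cx' : Continuous px' :=
    continuous_fst.comp (continuous_snd.comp (continuous_snd.comp continuous_snd))
  have cv : Continuous pv :=
    continuous_snd.comp (continuous_snd.comp (continuous_snd.comp continuous_snd))
  let M : Set P := {p | clSpan (px p) = f (pσ p)} ∩ {p | GoodParam (px p) (pg p) (px' p) (pv p)}
  have hM : MeasurableSet M :=
    (measurable_SB_eq _ _ (measurable_clSpan px cx) (hf.comp cσ.measurable)).inter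
      (measurable_good px pg px' pv cx cg cx' cv)
  have hex : ∀ σ, ∃ p ∈ M, pσ p = σ := by
    intro σ
    obtain ⟨x, g, x', v, h1, h2⟩ := exists_good (f σ)
    exact ⟨(σ, x, g, x', v), ⟨h1, h2⟩, rfl⟩
  have hMa := hM.analyticSet
  rw [AnalyticSet] at hMa
  rcases hMa with h0 | ⟨φ, hφ, hφM⟩
  · obtain ⟨p, hp, -⟩ := hex 0
    rw [h0] at hp
    exact hp.elim
  have hprops : ∀ p ∈ M, ¬ Embeds Z (clSpan (pg p)).1 ∧ HasSchauderBasis (clSpan (pg p)).1 ∧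
      EmbedsIsometrically (f (pσ p)).1 (clSpan (pg p)).1 := by
    rintro p ⟨h1, g1, g2, g3, g4, g5, g6, g7⟩
    have hX : ¬ Embeds Z (f (pσ p)).1 := hAsub ⟨_, rfl⟩
    have h1 : clSpan (px p) = f (pσ p) := h1
    rw [← h1] at hX ⊢
    exact good_props hmin hZl1 (px p) (pg p) (px' p) (pv p) g1 g2 g3 g4 g5 g6 g7 hX
  have hφmem : ∀ s, φ s ∈ M := fun s => hφM ▸ ⟨s, rfl⟩
  refine ⟨Set.range fun s => clSpan (pg (φ s)), ⟨_, measurable_clSpan _ (cg.comp hφ), rfl⟩,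
    ?_, ?_, ?_⟩
  · rintro _ ⟨s, rfl⟩
    exact (hprops _ (hφmem s)).1
  · rintro _ ⟨s, rfl⟩
    exact (hprops _ (hφmem s)).2.1
  · rintro _ ⟨σ, rfl⟩
    obtain ⟨p, hp, rfl⟩ := hex σ
    have hp' := hp
    rw [← hφM] at hp'
    obtain ⟨s, rfl⟩ := hp'
    exact ⟨_, ⟨s, rfl⟩, (hprops _ hp).2.2⟩
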